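/- arXiv:2411.11387 — 10 statements merged into one kernel-verified Lean document; each statement's English description precedes it below -/
import Mathlib

section
/- Let u,v be coprime positive integers with u ≥ 2 and set t = u/v. Let K(u,v) = {(r,s) ∈ ℤ² : 1 ≤ r ≤ u−1, 1 ≤ s ≤ v−1, vr + us < uv}, and define p₁(η,Δ) = f_u(η,Δ,t)·∏_{(r,s)∈K(u,v)} (Δ − h_{r,s;η}(t)) and p₂(η,Δ) = (f_u(η + 2/t, Δ − η − 1/t, t) − f_u(η,Δ,t))·(2Δ − η)·∏_{(r,s)∈K(u,v)} (Δ − h_{r,s;η}(t)). Then the set of simultaneous zeros {(η,Δ) ∈ ℂ² : p₁(η,Δ) = 0 and p₂(η,Δ) = 0} is exactly the union of {(pv/u, h_{r,0;pv/u}(t)) : r,p ∈ ℤ, 1 ≤ r ≤ u−1, 1−r ≤ p ≤ r−1, p + r ≡ 1 (mod 2)} and {(q, h_{r,s;q}(t)) : q ∈ ℂ, (r,s) ∈ K(u,v)}. (This identifies the one-dimensional simple modules of the Zhu algebra ℂ[Δ,η]/⟨p₁,p₂⟩ of the N=2 minimal model of central charge 3 − 6v/u.) -/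
/-- The recursively defined polynomials `f_n(x,y,z)`:
`f_2 = xz`, `f_3 = x²z²/2 − yz`, and
`f_{n+2} = ((2n+1)xz/(n+1)²) f_{n+1} − ((4yz + x²z² − (n−1)(n+1))/(n+1)²) f_n`. -/
noncomputable def fpoly : ℕ → ℂ → ℂ → ℂ → ℂ
  | 0, _, _, _ => 0
  | 1, _, _, _ => 0
  | 2, x, _, z => x * z
  | 3, x, y, z => x ^ 2 * z ^ 2 / 2 - y * z
  | n + 4, x, y, z =>
      (2 * ((n : ℂ) + 2) + 1) * x * z / ((n : ℂ) + 3) ^ 2 * fpoly (n + 3) x y z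
        - (4 * y * z + x ^ 2 * z ^ 2 - ((n : ℂ) + 1) * ((n : ℂ) + 3)) / ((n : ℂ) + 3) ^ 2 *
            fpoly (n + 2) x y z

/-- `h_{r,s;q}(t) = ((r − ts)² − 1)/(4t) − (t/4) q²`. -/
noncomputable def hwt (t r s q : ℂ) : ℂ := ((r - t * s) ^ 2 - 1) / (4 * t) - t / 4 * q ^ 2

open Polynomial in
/-- With `a = xz` and `c = 4yz + x²z² + 1`, the polynomial `f_n(x,y,z)` becomes a polynomial in `a`
given by a three-term recurrence with coefficients depending on `c`; it starts with `0, 1`. -/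
noncomputable def threeTermPoly (c : ℂ) : ℕ → ℂ[X]
  | 0 => 0
  | 1 => 1
  | n + 2 => C ((2 * (n : ℂ) + 1) / ((n : ℂ) + 1) ^ 2) * X * threeTermPoly c (n + 1)
      - C ((c - (n : ℂ) ^ 2) / ((n : ℂ) + 1) ^ 2) * threeTermPoly c n

namespace threeTermPoly

open Polynomial

@[simp] lemma eval_zero (c a : ℂ) : (threeTermPoly c 0).eval a = 0 := by
  simp [threeTermPoly]

@[simp] lemma eval_one (c a : ℂ) : (threeTermPoly c 1).eval a = 1 := by
  simp [threeTermPoly]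

lemma eval_recurrence (c a : ℂ) (n : ℕ) :
    ((n : ℂ) + 1) ^ 2 * (threeTermPoly c (n + 2)).eval a =
      (2 * (n : ℂ) + 1) * a * (threeTermPoly c (n + 1)).eval a
        - (c - (n : ℂ) ^ 2) * (threeTermPoly c n).eval a := by
  have h : (n : ℂ) + 1 ≠ 0 := Nat.cast_add_one_ne_zero n
  simp only [threeTermPoly, eval_sub, eval_mul, eval_C, eval_X]
  field_simp

lemma natDegree_le (c : ℂ) (n : ℕ) : (threeTermPoly c (n + 1)).natDegree ≤ n := by
  induction n using Nat.twoStepInduction with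
  | zero => simp [threeTermPoly]
  | one =>
    simp only [threeTermPoly]
    compute_degree
  | more n h₀ h₁ =>
    rw [threeTermPoly, mul_assoc]
    refine (natDegree_sub_le _ _).trans (max_le ?_ ?_)
    · refine (natDegree_C_mul_le _ _).trans (natDegree_mul_le.trans ?_)
      rw [natDegree_X]
      omega
    · exact (natDegree_C_mul_le _ _).trans (h₀.trans (by omega))

lemma coeff_ne_zero (c : ℂ) (n : ℕ) : (threeTermPoly c (n + 1)).coeff n ≠ 0 := by
  induction n with
  | zero => simp [threeTermPoly]
  | succ n ih =>
    have h : (threeTermPoly c n).coeff (n + 1) = 0 := by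
      cases n with
      | zero => simp [threeTermPoly]
      | succ n => exact coeff_eq_zero_of_natDegree_lt ((natDegree_le c n).trans_lt (by omega))
    have h₁ : (n : ℂ) + 1 ≠ 0 := Nat.cast_add_one_ne_zero n
    have h₂ : 2 * (n : ℂ) + 1 ≠ 0 := mod_cast (2 * n).succ_ne_zero
    rw [threeTermPoly, coeff_sub, coeff_C_mul, h, mul_zero, sub_zero, mul_assoc, coeff_C_mul,
      coeff_X_mul]
    exact mul_ne_zero (div_ne_zero h₂ (pow_ne_zero 2 h₁)) ih

lemma ne_zero (c : ℂ) (n : ℕ) : threeTermPoly c (n + 1) ≠ 0 := fun h =>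
  coeff_ne_zero c n (by simp [h])

/-- The shift `a ↦ a + 2` in terms of two consecutive members of the family. -/
lemma eval_add_two (c a : ℂ) (n : ℕ) :
    (c - (a + 1) ^ 2) * (threeTermPoly c (n + 1)).eval (a + 2) =
      (c - a ^ 2 - 1 - 2 * ((n : ℂ) + 1) * n - 2 * ((n : ℂ) + 1) * a) *
          (threeTermPoly c (n + 1)).eval a
        + 2 * (c - (n : ℂ) ^ 2) * (threeTermPoly c n).eval a := by
  induction n using Nat.twoStepInduction with
  | zero => simp; ring
  | one =>
    have h := eval_recurrence c a 0
    have h' := eval_recurrence c (a + 2) 0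
    norm_num at h h' ⊢
    rw [h, h']
    ring
  | more n h₀ h₁ =>
    have r₀ := eval_recurrence c a n
    have r₁ := eval_recurrence c a (n + 1)
    have r₂ := eval_recurrence c (a + 2) (n + 1)
    have hn : ((n : ℂ) + 2) ^ 2 ≠ 0 := pow_ne_zero 2 (mod_cast (n + 1).succ_ne_zero)
    push_cast at *
    apply mul_left_cancel₀ hn
    linear_combination (c - (a + 1) ^ 2) * r₂ + (2 * ((n : ℂ) + 1) + 1) * (a + 2) * h₁
      - (c - ((n : ℂ) + 1) ^ 2) * h₀
      - (c - a ^ 2 - 1 - 2 * ((n : ℂ) + 3) * (n + 2) - 2 * ((n : ℂ) + 3) * a) * r₁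
      - 2 * (c - ((n : ℂ) + 1) ^ 2) * r₀

/-- At `c = r²` the member of degree `r` vanishes at the weights `r - 1, r - 3, …, 1 - r`. -/
lemma eval_sq_succ_eq_zero {r j : ℕ} (hj : j < r) :
    (threeTermPoly ((r : ℂ) ^ 2) (r + 1)).eval ((r : ℂ) - 1 - 2 * j) = 0 := by
  have step : ∀ a : ℂ, a + r + 1 ≠ 0 →
      ((r : ℂ) ^ 2 - (a + 1) ^ 2) * (threeTermPoly ((r : ℂ) ^ 2) (r + 1)).eval (a + 2) = 0 →
      (threeTermPoly ((r : ℂ) ^ 2) (r + 1)).eval a = 0 := by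
    intro a ha h
    have h' := eval_add_two ((r : ℂ) ^ 2) a r
    rw [h] at h'
    have : (a + r + 1) ^ 2 * (threeTermPoly ((r : ℂ) ^ 2) (r + 1)).eval a = 0 := by
      linear_combination h'
    exact (mul_eq_zero.mp this).resolve_left (pow_ne_zero 2 ha)
  have hne : ∀ i : ℕ, i < r → (r : ℂ) - 1 - 2 * i + r + 1 ≠ 0 := by
    intro i hi h
    have : (r : ℂ) = i := by linear_combination h / 2
    exact hi.ne' (mod_cast this)
  induction j with
  | zero => exact step _ (hne 0 hj) (by push_cast; ring)
  | succ j ih =>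
    refine step _ (hne _ hj) ?_
    have : (r : ℂ) - 1 - 2 * ((j + 1 : ℕ) : ℂ) + 2 = r - 1 - 2 * j := by push_cast; ring
    rw [this, ih (by omega), mul_zero]

/-- The weights `r - 1, r - 3, …, 1 - r` are the only zeros of the member of degree `r`. -/
lemma exists_of_eval_sq_succ_eq_zero {r : ℕ} {a : ℂ}
    (h : (threeTermPoly ((r : ℂ) ^ 2) (r + 1)).eval a = 0) :
    ∃ j < r, a = (r : ℂ) - 1 - 2 * j := by
  by_contra! hcon
  have hinj : Function.Injective fun j : ℕ => (r : ℂ) - 1 - 2 * j := by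
    intro i j hij
    have : (i : ℂ) = j := by
      simp only at hij
      linear_combination -hij / 2
    exact_mod_cast this
  set s : Finset ℂ := (Finset.range r).image fun j : ℕ => (r : ℂ) - 1 - 2 * j with hs
  have ha : a ∉ s := by
    simp only [hs, Finset.mem_image, Finset.mem_range, not_exists, not_and]
    exact fun j hj => (hcon j hj).symm
  refine ne_zero ((r : ℂ) ^ 2) r
    (eq_zero_of_natDegree_lt_card_of_eval_eq_zero' _ (insert a s) ?_ ?_)
  · intro b hb
    rcases Finset.mem_insert.mp hb with rfl | hb
    · exact h
    · obtain ⟨j, hj, rfl⟩ := Finset.mem_image.mp hb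
      exact eval_sq_succ_eq_zero (Finset.mem_range.mp hj)
  · rw [Finset.card_insert_of_notMem ha, Finset.card_image_of_injective _ hinj, Finset.card_range]
    exact (natDegree_le _ r).trans_lt r.lt_succ_self

lemma eval_sq_eq_zero {r n : ℕ} {a : ℂ}
    (h : (threeTermPoly ((r : ℂ) ^ 2) (r + 1)).eval a = 0) (hn : r < n) :
    (threeTermPoly ((r : ℂ) ^ 2) n).eval a = 0 := by
  obtain ⟨k, rfl⟩ := Nat.exists_eq_add_of_lt hn
  induction k using Nat.twoStepInduction with
  | zero => exact h
  | one =>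
    have h' := eval_recurrence ((r : ℂ) ^ 2) a r
    rw [h, sub_self, zero_mul, mul_zero, sub_zero] at h'
    exact (mul_eq_zero.mp h').resolve_left (pow_ne_zero 2 (Nat.cast_add_one_ne_zero r))
  | more k h₀ h₁ =>
    have h' := eval_recurrence ((r : ℂ) ^ 2) a (r + k + 1)
    rw [h₀ (by omega), show r + k + 1 + 1 = r + (k + 1) + 1 by ring, h₁ (by omega), mul_zero,
      mul_zero, sub_zero] at h'
    exact (mul_eq_zero.mp h').resolve_left (pow_ne_zero 2 (Nat.cast_add_one_ne_zero _))

lemma exists_sq_of_eval_eq_zero {c a : ℂ} {n : ℕ} (h : (threeTermPoly c (n + 1)).eval a = 0)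
    (h' : (c - (n : ℂ) ^ 2) * (threeTermPoly c n).eval a = 0) :
    ∃ r ≤ n, c = (r : ℂ) ^ 2 ∧ (threeTermPoly c (r + 1)).eval a = 0 := by
  induction n with
  | zero => simp at h
  | succ n ih =>
    rcases mul_eq_zero.mp h' with hc | hg
    · exact ⟨n + 1, le_rfl, sub_eq_zero.mp hc, h⟩
    · have hr := eval_recurrence c a n
      rw [h, hg, mul_zero, mul_zero, zero_sub, zero_eq_neg] at hr
      obtain ⟨r, hr, hcr⟩ := ih hg hr
      exact ⟨r, by omega, hcr⟩

theorem eval_eq_zero_and_shift_iff (c a : ℂ) (n : ℕ) :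
    ((threeTermPoly c (n + 1)).eval a = 0 ∧
        (c - (a + 1) ^ 2) * (threeTermPoly c (n + 1)).eval (a + 2) = 0) ↔
      ∃ r ≤ n, ∃ j < r, c = (r : ℂ) ^ 2 ∧ a = (r : ℂ) - 1 - 2 * j := by
  constructor
  · rintro ⟨h, h'⟩
    rw [eval_add_two, h, mul_zero, zero_add, mul_assoc] at h'
    obtain ⟨r, hr, rfl, hra⟩ :=
      exists_sq_of_eval_eq_zero h ((mul_eq_zero.mp h').resolve_left two_ne_zero)
    obtain ⟨j, hj, rfl⟩ := exists_of_eval_sq_succ_eq_zero hra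
    exact ⟨r, hr, j, hj, rfl, rfl⟩
  · rintro ⟨r, hr, j, hj, rfl, rfl⟩
    refine ⟨eval_sq_eq_zero (eval_sq_succ_eq_zero hj) (by omega), ?_⟩
    cases j with
    | zero => push_cast; ring
    | succ j =>
      have : (r : ℂ) - 1 - 2 * ((j + 1 : ℕ) : ℂ) + 2 = r - 1 - 2 * j := by push_cast; ring
      rw [this, eval_sq_eq_zero (eval_sq_succ_eq_zero (by omega)) (by omega), mul_zero]

end threeTermPoly

lemma fpoly_add_two (n : ℕ) (x y z : ℂ) :
    fpoly (n + 2) x y z =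
      (threeTermPoly (4 * y * z + x ^ 2 * z ^ 2 + 1) (n + 2)).eval (x * z) := by
  induction n using Nat.twoStepInduction with
  | zero => simp [fpoly, threeTermPoly]
  | one =>
    simp [fpoly, threeTermPoly]
    ring
  | more n h₀ h₁ =>
    have h := threeTermPoly.eval_recurrence (4 * y * z + x ^ 2 * z ^ 2 + 1) (x * z) (n + 2)
    have hn : ((n : ℂ) + 3) ≠ 0 := mod_cast (n + 2).succ_ne_zero
    push_cast at h
    rw [fpoly, h₀, h₁]
    generalize threeTermPoly (4 * y * z + x ^ 2 * z ^ 2 + 1) = P at h ⊢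
    apply mul_left_cancel₀ (pow_ne_zero 2 hn)
    field_simp
    linear_combination -h

lemma fpoly_eq_zero_and_shift_iff {u : ℕ} (hu : 2 ≤ u) {t : ℂ} (ht : t ≠ 0) (η Δ : ℂ) :
    (fpoly u η Δ t = 0 ∧
        (fpoly u (η + 2 / t) (Δ - η - 1 / t) t - fpoly u η Δ t) * (2 * Δ - η) = 0) ↔
      ∃ r q : ℤ, 1 ≤ r ∧ r ≤ (u : ℤ) - 1 ∧ 1 - r ≤ q ∧ q ≤ r - 1 ∧ Odd (q + r) ∧
        η = (q : ℂ) / t ∧ Δ = hwt t (r : ℂ) 0 ((q : ℂ) / t) := by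
  obtain ⟨n, rfl⟩ := Nat.exists_eq_add_of_le' hu
  have hshift : 4 * (Δ - η - 1 / t) * t + (η + 2 / t) ^ 2 * t ^ 2 + 1 =
      4 * Δ * t + η ^ 2 * t ^ 2 + 1 := by
    field_simp
    ring
  have harg : (η + 2 / t) * t = η * t + 2 := by field_simp
  rw [fpoly_add_two, fpoly_add_two, hshift, harg]
  set c := 4 * Δ * t + η ^ 2 * t ^ 2 + 1 with hc
  have hfac : 2 * Δ - η = (c - (η * t + 1) ^ 2) / (2 * t) := by
    rw [hc]
    field_simp
    ring
  have hiff := threeTermPoly.eval_eq_zero_and_shift_iff c (η * t) (n + 1)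
  have hleft : ∀ A B : ℂ, (A = 0 ∧ (B - A) * (2 * Δ - η) = 0) ↔
      (A = 0 ∧ (c - (η * t + 1) ^ 2) * B = 0) := by
    intro A B
    refine and_congr_right fun hA => ?_
    rw [hA, sub_zero, hfac, ← mul_div_assoc, div_eq_zero_iff, mul_comm B]
    simp [ht]
  rw [hleft, hiff]
  have hparam : ∀ r a : ℂ, (c = r ^ 2 ∧ η * t = a) ↔ (η = a / t ∧ Δ = hwt t r 0 (a / t)) := by
    intro r a
    rw [eq_div_iff ht, and_comm]
    refine and_congr_right fun ha => ?_
    rw [hwt, ← ha, hc]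
    field_simp
    constructor
    · intro h
      linear_combination h
    · intro h
      linear_combination h
  constructor
  · rintro ⟨r, hr, j, hj, h⟩
    refine ⟨r, r - 1 - 2 * j, by omega, by push_cast; omega, by omega, by omega,
      ⟨r - j - 1, by ring⟩, ?_⟩
    push_cast
    exact (hparam _ _).mp h
  · rintro ⟨r, q, h₁, h₂, h₃, h₄, ⟨k, hk⟩, h⟩
    refine ⟨r.toNat, by omega, (r - 1 - k).toNat, by omega, ?_⟩
    have hr : ((r.toNat : ℕ) : ℂ) = r := mod_cast Int.toNat_of_nonneg (by omega)
    have hj : (((r - 1 - k).toNat : ℕ) : ℂ) = r - 1 - k := by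
      exact_mod_cast congrArg (Int.cast (R := ℂ)) (Int.toNat_of_nonneg (a := r - 1 - k) (by omega))
    have hq : (q : ℂ) = r - 1 - 2 * (r - 1 - k) := by
      have : q = r - 1 - 2 * (r - 1 - k) := by linarith
      exact_mod_cast this
    rw [hr, hj, ← hq]
    exact (hparam _ _).mpr h

/-- The set of simultaneous zeros of the two generators `p₁, p₂` of the image of the maximal
ideal in the Zhu algebra of the `N = 2` minimal model of central charge `3 − 6v/u` is exactly
the union of the two families of weights of the simple one-dimensional Zhu modules. -/
theorem simultaneous_zeros_of_Zhu_ideal_generators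
    (u v : ℕ) (hu : 2 ≤ u) (hv : 1 ≤ v) (huv : Nat.Coprime u v) :
    let t : ℂ := (u : ℂ) / (v : ℂ)
    let K : Finset (ℕ × ℕ) :=
      (Finset.Icc 1 (u - 1) ×ˢ Finset.Icc 1 (v - 1)).filter fun rs => v * rs.1 + u * rs.2 < u * v
    let p₁ : ℂ → ℂ → ℂ := fun η Δ =>
      fpoly u η Δ t * ∏ rs ∈ K, (Δ - hwt t (rs.1 : ℂ) (rs.2 : ℂ) η)
    let p₂ : ℂ → ℂ → ℂ := fun η Δ =>
      (fpoly u (η + 2 / t) (Δ - η - 1 / t) t - fpoly u η Δ t) * (2 * Δ - η) *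
        ∏ rs ∈ K, (Δ - hwt t (rs.1 : ℂ) (rs.2 : ℂ) η)
    {p : ℂ × ℂ | p₁ p.1 p.2 = 0 ∧ p₂ p.1 p.2 = 0} =
      {p : ℂ × ℂ | ∃ r q : ℤ, 1 ≤ r ∧ r ≤ (u : ℤ) - 1 ∧ 1 - r ≤ q ∧ q ≤ r - 1 ∧
          Odd (q + r) ∧ p.1 = (q : ℂ) * (v : ℂ) / (u : ℂ) ∧
          p.2 = hwt t (r : ℂ) 0 ((q : ℂ) * (v : ℂ) / (u : ℂ))} ∪
      {p : ℂ × ℂ | ∃ rs ∈ K, p.2 = hwt t (rs.1 : ℂ) (rs.2 : ℂ) p.1} := by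
  intro t K p₁ p₂
  have hu₀ : (u : ℂ) ≠ 0 := by exact_mod_cast (by omega : u ≠ 0)
  have hv₀ : (v : ℂ) ≠ 0 := by exact_mod_cast (by omega : v ≠ 0)
  have hdiv : ∀ q : ℂ, q * (v : ℂ) / (u : ℂ) = q / t := fun q => by
    simp only [t]
    field_simp
  ext ⟨η, Δ⟩
  simp only [Set.mem_union, Set.mem_ofPred_eq, p₁, p₂, hdiv]
  rw [← fpoly_eq_zero_and_shift_iff hu (div_ne_zero hu₀ hv₀) η Δ, mul_eq_zero, mul_eq_zero,
    ← and_or_right, Finset.prod_eq_zero_iff]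
  simp only [sub_eq_zero]
  rfl
end

section
/- Let u,v be coprime positive integers with u ≥ 2. For all integers r,p with 1 ≤ r ≤ u−1, 1−r ≤ p ≤ r−1 and p + r odd, one has f_u(pv/u, h_{r,0;pv/u}(u/v), u/v) = 0. -/
open Finset in
/-- The coefficient of `(x choose k)` in the discrete Chebyshev polynomial of degree `n` on `N`
points, normalised as in `discreteChebyshev`. -/
noncomputable def discreteChebyshevCoeff (N : ℂ) (n k : ℕ) : ℂ :=
  if k ≤ n then
    ((n + k).factorial : ℂ) / (n.factorial * k.factorial * (n - k).factorial) *
      ∏ i ∈ range (n - k), (1 - N + k + i)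
  else 0

/-- The binomial coefficient `(x choose k)` for complex `x`. -/
noncomputable def complexChoose (x : ℂ) (k : ℕ) : ℂ :=
  ∏ i ∈ Finset.range k, (x - i) / (i + 1)

/-- The discrete Chebyshev (Gram) polynomial of degree `n` on `N` points, divided by `n!`. -/
noncomputable def discreteChebyshev (N x : ℂ) (n : ℕ) : ℂ :=
  ∑ k ∈ Finset.range (n + 1), discreteChebyshevCoeff N n k * complexChoose x k

lemma succ_mul_complexChoose_succ (x : ℂ) (k : ℕ) :
    (k + 1) * complexChoose x (k + 1) = (x - k) * complexChoose x k := by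
  have : (k : ℂ) + 1 ≠ 0 := Nat.cast_add_one_ne_zero k
  rw [complexChoose, Finset.prod_range_succ, ← complexChoose]
  field_simp

lemma complexChoose_eq_zero {x k : ℕ} (h : x < k) : complexChoose x k = 0 :=
  Finset.prod_eq_zero (Finset.mem_range.2 h) (by simp)

lemma discreteChebyshevCoeff_of_lt (N : ℂ) {n k : ℕ} (h : n < k) :
    discreteChebyshevCoeff N n k = 0 := if_neg (by omega)

lemma discreteChebyshevCoeff_add (N : ℂ) (j k : ℕ) :
    discreteChebyshevCoeff N (k + j) k =
      ((2 * k + j).factorial : ℂ) / ((k + j).factorial * k.factorial * j.factorial) *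
        ∏ i ∈ Finset.range j, (1 - N + k + i) := by
  rw [discreteChebyshevCoeff, if_pos (by omega), show k + j - k = j by omega,
    show k + j + k = 2 * k + j by ring]

lemma discreteChebyshevCoeff_recurrence_zero (N : ℂ) (n : ℕ) :
    ((n : ℂ) + 2) ^ 2 * discreteChebyshevCoeff N (n + 2) 0 +
        (N ^ 2 - (n + 1) ^ 2) * discreteChebyshevCoeff N n 0 =
      (2 * n + 3) * (1 - N) * discreteChebyshevCoeff N (n + 1) 0 := by
  have h0 := discreteChebyshevCoeff_add N n 0
  have h1 := discreteChebyshevCoeff_add N (n + 1) 0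
  have h2 := discreteChebyshevCoeff_add N (n + 2) 0
  simp only [zero_add, mul_zero] at h0 h1 h2
  rw [h0, h1, h2]
  simp only [Finset.prod_range_succ, Nat.factorial_succ, Nat.factorial_zero]
  generalize ∏ i ∈ Finset.range n, (1 - N + ((0 : ℕ) : ℂ) + (i : ℂ)) = P
  have hn : (n.factorial : ℂ) ≠ 0 := by exact_mod_cast n.factorial_ne_zero
  have hn1 : (n : ℂ) + 1 ≠ 0 := by exact_mod_cast n.succ_ne_zero
  have hn2 : (n : ℂ) + 1 + 1 ≠ 0 := by exact_mod_cast (n + 1).succ_ne_zero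
  push_cast
  field_simp
  ring

lemma discreteChebyshevCoeff_recurrence_succ (N : ℂ) (n k : ℕ) :
    ((n : ℂ) + 2) ^ 2 * discreteChebyshevCoeff N (n + 2) (k + 1) +
        (N ^ 2 - (n + 1) ^ 2) * discreteChebyshevCoeff N n (k + 1) =
      (2 * n + 3) * (2 * (k + 1) * discreteChebyshevCoeff N (n + 1) k +
        (2 * (k + 1) + 1 - N) * discreteChebyshevCoeff N (n + 1) (k + 1)) := by
  have hk : (k.factorial : ℂ) ≠ 0 := by exact_mod_cast k.factorial_ne_zero
  have hk1 : (k : ℂ) + 1 ≠ 0 := by exact_mod_cast k.succ_ne_zero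
  have hk2 : (k : ℂ) + 1 + 1 ≠ 0 := by exact_mod_cast (k + 1).succ_ne_zero
  rcases lt_trichotomy n k with h | rfl | h
  · rw [discreteChebyshevCoeff_of_lt N (show n < k + 1 by omega),
      discreteChebyshevCoeff_of_lt N (show n + 1 < k + 1 by omega)]
    rcases Nat.lt_or_ge (n + 1) k with h' | h'
    · rw [discreteChebyshevCoeff_of_lt N (show n + 2 < k + 1 by omega),
        discreteChebyshevCoeff_of_lt N h']
      ring
    · obtain rfl : k = n + 1 := by omega
      have h1 := discreteChebyshevCoeff_add N 0 (n + 1)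
      have h2 := discreteChebyshevCoeff_add N 0 (n + 2)
      simp only [add_zero] at h1 h2
      rw [h1, h2, show 2 * (n + 2) = 2 * (n + 1) + 1 + 1 by ring]
      simp only [Nat.factorial_succ (2 * (n + 1) + 1), Nat.factorial_succ (2 * (n + 1)),
        Nat.factorial_succ (n + 1), Finset.prod_range_zero, Nat.factorial_zero]
      push_cast at *
      field_simp
      ring
  · have h1 := discreteChebyshevCoeff_add N 1 n
    have h2 := discreteChebyshevCoeff_add N 1 (n + 1)
    have h3 := discreteChebyshevCoeff_add N 0 (n + 1)
    simp only [add_zero, add_assoc, Nat.reduceAdd] at h1 h2 h3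
    rw [discreteChebyshevCoeff_of_lt N (Nat.lt_succ_self n), h1, h2, h3,
      show 2 * (n + 1) + 1 = 2 * n + 1 + 1 + 1 by ring, show 2 * (n + 1) = 2 * n + 1 + 1 by ring]
    simp only [Nat.factorial_succ, Finset.prod_range_succ, Finset.prod_range_zero,
      Nat.factorial_zero]
    push_cast
    field_simp
    ring
  · obtain ⟨j, rfl⟩ : ∃ j, n = k + 1 + j := ⟨n - (k + 1), by omega⟩
    have h0 := discreteChebyshevCoeff_add N j (k + 1)
    have h1 := discreteChebyshevCoeff_add N (j + 1) (k + 1)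
    have h2 := discreteChebyshevCoeff_add N (j + 2) (k + 1)
    have h3 := discreteChebyshevCoeff_add N (j + 2) k
    rw [show k + (j + 2) = k + 1 + j + 1 by ring] at h3
    have hP : ∏ i ∈ Finset.range (j + 2), (1 - N + (k : ℂ) + i) =
        (1 - N + k) * ∏ i ∈ Finset.range (j + 1), (1 - N + ((k + 1 : ℕ) : ℂ) + i) := by
      rw [Finset.prod_range_succ', mul_comm]
      congr 1
      · simp
      · exact Finset.prod_congr rfl fun i _ ↦ by push_cast; ring
    rw [show k + 1 + j + 2 = k + 1 + (j + 2) by ring, h2, h0, h3, hP,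
      show k + 1 + j + 1 = k + 1 + (j + 1) by ring, h1,
      show 2 * (k + 1) + (j + 2) = 2 * k + j + 1 + 1 + 1 + 1 by ring,
      show 2 * (k + 1) + (j + 1) = 2 * k + j + 1 + 1 + 1 by ring,
      show 2 * (k + 1) + j = 2 * k + j + 1 + 1 by ring,
      show 2 * k + (j + 2) = 2 * k + j + 1 + 1 by ring,
      show k + 1 + (j + 2) = k + j + 1 + 1 + 1 by ring,
      show k + 1 + (j + 1) = k + j + 1 + 1 by ring,
      show k + 1 + j = k + j + 1 by ring]
    simp only [Finset.prod_range_succ, Nat.factorial_succ]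
    generalize ∏ i ∈ Finset.range j, (1 - N + ((k + 1 : ℕ) : ℂ) + (i : ℂ)) = P
    have hj : (j.factorial : ℂ) ≠ 0 := by exact_mod_cast j.factorial_ne_zero
    have hj1 : (j : ℂ) + 1 ≠ 0 := by exact_mod_cast j.succ_ne_zero
    have hj2 : (j : ℂ) + 1 + 1 ≠ 0 := by exact_mod_cast (j + 1).succ_ne_zero
    have hf : ((k + j).factorial : ℂ) ≠ 0 := by exact_mod_cast (k + j).factorial_ne_zero
    have hf1 : (k : ℂ) + j + 1 ≠ 0 := by exact_mod_cast (k + j).succ_ne_zero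
    have hf2 : (k : ℂ) + j + 1 + 1 ≠ 0 := by exact_mod_cast (k + j + 1).succ_ne_zero
    have hf3 : (k : ℂ) + j + 1 + 1 + 1 ≠ 0 := by exact_mod_cast (k + j + 2).succ_ne_zero
    push_cast
    generalize ((2 * k + j).factorial : ℂ) = F
    generalize ((k + j).factorial : ℂ) = G at *
    generalize (k.factorial : ℂ) = K at *
    generalize (j.factorial : ℂ) = J at *
    generalize (k : ℂ) = a at *
    generalize (j : ℂ) = b at *
    rw [show a + b + 1 + 2 = a + b + 1 + 1 + 1 by ring,
      show a + b + 2 + 1 = a + b + 1 + 1 + 1 by ring]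
    field_simp
    ring

lemma sum_discreteChebyshevCoeff_recurrence (N x : ℂ) (n M : ℕ) :
    ∑ k ∈ Finset.range (M + 1), (((n : ℂ) + 2) ^ 2 * discreteChebyshevCoeff N (n + 2) k
        - (2 * n + 3) * (2 * x + 1 - N) * discreteChebyshevCoeff N (n + 1) k
        + (N ^ 2 - (n + 1) ^ 2) * discreteChebyshevCoeff N n k) * complexChoose x k =
      -(2 * n + 3) * 2 * (x - M) * discreteChebyshevCoeff N (n + 1) M * complexChoose x M := by
  induction M with
  | zero =>
    have h := discreteChebyshevCoeff_recurrence_zero N n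
    rw [zero_add, Finset.sum_range_one]
    push_cast
    linear_combination complexChoose x 0 * h
  | succ M ih =>
    have h := discreteChebyshevCoeff_recurrence_succ N n M
    rw [Finset.sum_range_succ, ih]
    push_cast
    linear_combination complexChoose x (M + 1) * h +
      (2 * n + 3) * 2 * discreteChebyshevCoeff N (n + 1) M * succ_mul_complexChoose_succ x M

lemma discreteChebyshev_eq_sum_range (N x : ℂ) {n M : ℕ} (h : n < M) :
    discreteChebyshev N x n =
      ∑ k ∈ Finset.range M, discreteChebyshevCoeff N n k * complexChoose x k := by
  refine Finset.sum_subset (Finset.range_subset_range.2 h) fun k _ hk ↦ ?_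
  rw [discreteChebyshevCoeff_of_lt N (by simpa using hk), zero_mul]

/-- The three-term recurrence of the discrete Chebyshev polynomials. -/
lemma discreteChebyshev_recurrence (N x : ℂ) (n : ℕ) :
    ((n : ℂ) + 2) ^ 2 * discreteChebyshev N x (n + 2) =
      (2 * n + 3) * (2 * x + 1 - N) * discreteChebyshev N x (n + 1)
        - (N ^ 2 - (n + 1) ^ 2) * discreteChebyshev N x n := by
  have h := sum_discreteChebyshevCoeff_recurrence N x n (n + 2)
  rw [discreteChebyshevCoeff_of_lt N (show n + 1 < n + 2 by omega)] at h
  simp only [add_mul, sub_mul, Finset.sum_add_distrib, Finset.sum_sub_distrib, mul_assoc,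
    ← Finset.mul_sum] at h
  rw [← discreteChebyshev_eq_sum_range N x (show n + 2 < n + 2 + 1 by omega),
    ← discreteChebyshev_eq_sum_range N x (show n + 1 < n + 2 + 1 by omega),
    ← discreteChebyshev_eq_sum_range N x (show n < n + 2 + 1 by omega)] at h
  linear_combination h

lemma discreteChebyshev_zero (N x : ℂ) : discreteChebyshev N x 0 = 1 := by
  simp [discreteChebyshev, discreteChebyshevCoeff, complexChoose]

lemma discreteChebyshev_one (N x : ℂ) : discreteChebyshev N x 1 = 2 * x + 1 - N := by
  simp [discreteChebyshev, discreteChebyshevCoeff, complexChoose, Finset.sum_range_succ]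
  ring

/-- The discrete Chebyshev polynomial of degree `N` vanishes on the `N` points `0, …, N - 1`. -/
lemma discreteChebyshev_self {N x : ℕ} (hx : x < N) : discreteChebyshev N x N = 0 := by
  refine Finset.sum_eq_zero fun k hk ↦ ?_
  rcases (Nat.lt_succ_iff.1 (Finset.mem_range.1 hk)).lt_or_eq with h | rfl
  · obtain ⟨j, rfl⟩ : ∃ j, N = k + (j + 1) := ⟨N - k - 1, by omega⟩
    rw [discreteChebyshevCoeff_add, Finset.prod_eq_zero (Finset.self_mem_range_succ j)]
    · simp
    · push_cast
      ring
  · rw [complexChoose_eq_zero hx, mul_zero]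

lemma discreteChebyshev_of_le {N x n : ℕ} (hx : x < N) (hn : N ≤ n) :
    discreteChebyshev N x n = 0 := by
  suffices h : discreteChebyshev N x n = 0 ∧ discreteChebyshev N x (n + 1) = 0 from h.1
  induction n, hn using Nat.le_induction with
  | base =>
    refine ⟨discreteChebyshev_self hx, ?_⟩
    obtain ⟨m, rfl⟩ : ∃ m, N = m + 1 := ⟨N - 1, by omega⟩
    have h := discreteChebyshev_recurrence ((m + 1 : ℕ) : ℂ) x m
    rw [discreteChebyshev_self hx] at h
    have hm : ((m : ℂ) + 2) ^ 2 ≠ 0 := pow_ne_zero 2 (by exact_mod_cast (m + 1).succ_ne_zero)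
    refine (mul_eq_zero.1 ?_).resolve_left hm
    rw [h]
    push_cast
    ring
  | succ n _ ih =>
    refine ⟨ih.2, ?_⟩
    have h := discreteChebyshev_recurrence (N : ℂ) x n
    rw [ih.1, ih.2, mul_zero, mul_zero, sub_zero] at h
    have hm : ((n : ℂ) + 2) ^ 2 ≠ 0 := pow_ne_zero 2 (by exact_mod_cast (n + 1).succ_ne_zero)
    exact (mul_eq_zero.1 h).resolve_left hm

lemma fpoly_eq_discreteChebyshev {x y z N w : ℂ} (hx : x * z = 2 * w + 1 - N)
    (hy : 4 * y * z + x ^ 2 * z ^ 2 = N ^ 2 - 1) (n : ℕ) :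
    fpoly (n + 2) x y z = discreteChebyshev N w (n + 1) := by
  induction n using Nat.strong_induction_on with
  | _ n ih =>
    match n with
    | 0 => rw [fpoly, discreteChebyshev_one, hx]
    | 1 =>
      have h := discreteChebyshev_recurrence N w 0
      rw [discreteChebyshev_zero, discreteChebyshev_one, ← hx] at h
      rw [fpoly]
      push_cast at h
      linear_combination -h / 4 - hy / 4
    | n + 2 =>
      have h := discreteChebyshev_recurrence N w (n + 1)
      rw [fpoly, ih n (by omega), ih (n + 1) (by omega), hy, mul_assoc _ x z, hx]
      have hn : (n : ℂ) + 3 ≠ 0 := by exact_mod_cast (n + 2).succ_ne_zero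
      push_cast at h
      field_simp
      linear_combination -h

/-- For coprime `u ≥ 2`, `v ≥ 1` and integers `r, p` with `1 ≤ r ≤ u−1`, `1−r ≤ p ≤ r−1`
and `p + r` odd, one has `f_u(pv/u, h_{r,0;pv/u}(u/v), u/v) = 0`. -/
theorem fpoly_vanishing_first_family
    (u v : ℕ) (hu : 2 ≤ u) (hv : 1 ≤ v) (huv : Nat.Coprime u v)
    (r p : ℤ) (hr1 : 1 ≤ r) (hr2 : r ≤ (u : ℤ) - 1)
    (hp1 : 1 - r ≤ p) (hp2 : p ≤ r - 1) (hodd : Odd (p + r)) :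
    fpoly u ((p : ℂ) * (v : ℂ) / (u : ℂ))
        (hwt ((u : ℂ) / (v : ℂ)) (r : ℂ) 0 ((p : ℂ) * (v : ℂ) / (u : ℂ)))
        ((u : ℂ) / (v : ℂ)) = 0 := by
  obtain ⟨N, rfl⟩ : ∃ N : ℕ, r = N := ⟨r.toNat, by omega⟩
  obtain ⟨w, hw⟩ : ∃ w : ℕ, p = 2 * w + 1 - N := by
    obtain ⟨m, hm⟩ := hodd
    exact ⟨m.toNat, by omega⟩
  obtain ⟨n, rfl⟩ : ∃ n, u = n + 2 := ⟨u - 2, by omega⟩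
  have hu0 : ((n + 2 : ℕ) : ℂ) ≠ 0 := by exact_mod_cast (n + 1).succ_ne_zero
  have hv0 : (v : ℂ) ≠ 0 := by exact_mod_cast (show v ≠ 0 by omega)
  have hpw : (p : ℂ) = 2 * w + 1 - N := by exact_mod_cast congrArg (Int.cast : ℤ → ℂ) hw
  rw [fpoly_eq_discreteChebyshev (N := N) (w := w)]
  · exact discreteChebyshev_of_le (by omega) (by omega)
  · rw [← hpw]
    field_simp
  · rw [hwt, Int.cast_natCast]
    field_simp
    ring
end

section
/- Let u,v be coprime positive integers with u ≥ 2 and set t = u/v. For all integers r,p with 1 ≤ r ≤ u−1, 1−r ≤ p ≤ r−1 and p + r odd, one has f_u(pv/u + 2v/u, h_{r,0;pv/u}(t) − pv/u − v/u, t) · (2·h_{r,0;pv/u}(t) − pv/u) = 0. -/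
open Complex Finset

/-- The `j`-th summand, up to the factor `k.choose j`, of the hypergeometric form of the discrete
Chebyshev (Gram) polynomial of degree `n` on `N` points. The reciprocal Gamma values vanish at the
poles of `Gamma`, which makes the contiguity relations below hold without side conditions. -/
noncomputable def gramCoeff (N n j : ℕ) : ℂ :=
  (-1) ^ j * (n + j).factorial * (N - 1 - j).factorial / (j.factorial * n.factorial) *
    (Gamma ((n : ℂ) - j + 1))⁻¹ * (Gamma ((N : ℂ) - n))⁻¹

/-- The discrete Chebyshev (Gram) polynomial of degree `n` on `N` points, at the point `k`. -/
noncomputable def gramSum (N n k : ℕ) : ℂ := ∑ j ∈ range (k + 1), (k.choose j : ℂ) * gramCoeff N n j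

lemma inv_Gamma_eq (s s' : ℂ) (h : s' = s + 1) : (Gamma s)⁻¹ = s * (Gamma s')⁻¹ := by
  rw [h]
  exact one_div_Gamma_eq_self_mul_one_div_Gamma_add_one s

lemma gramCoeff_recurrence_zero (N n : ℕ) :
    ((n : ℂ) + 2) ^ 2 * gramCoeff N (n + 2) 0 =
      (2 * n + 3) * (N - 1) * gramCoeff N (n + 1) 0
        - ((N : ℂ) ^ 2 - (n + 1) ^ 2) * gramCoeff N n 0 := by
  have hn : (n.factorial : ℂ) ≠ 0 := by exact_mod_cast n.factorial_ne_zero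
  have h1 : (n : ℂ) + 1 ≠ 0 := by exact_mod_cast n.succ_ne_zero
  have h2 : (n : ℂ) + 2 ≠ 0 := by exact_mod_cast (n + 1).succ_ne_zero
  have e1 := inv_Gamma_eq ((n : ℂ) + 1) (n + 2) (by ring)
  have e2 := inv_Gamma_eq ((n : ℂ) + 2) (n + 3) (by ring)
  have e3 := inv_Gamma_eq ((N : ℂ) - (n + 1)) (N - n) (by ring)
  have e4 := inv_Gamma_eq ((N : ℂ) - (n + 2)) (N - (n + 1)) (by ring)
  have a1 : (n : ℂ) + 1 + 1 = n + 2 := by ring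
  have a2 : (n : ℂ) + 2 + 1 = n + 3 := by ring
  simp only [gramCoeff, Nat.factorial_succ, add_zero, pow_zero, Nat.factorial_zero, Nat.cast_add,
    Nat.cast_mul, Nat.cast_one, Nat.cast_ofNat, Nat.cast_zero, sub_zero, a1, a2, e4, e3, e1, e2]
  field_simp
  ring

lemma gramCoeff_recurrence_succ (N n j : ℕ) (hj : j + 1 < N) :
    ((n : ℂ) + 2) ^ 2 * gramCoeff N (n + 2) (j + 1) =
      (2 * n + 3) * ((N - 1 - 2 * (j + 1)) * gramCoeff N (n + 1) (j + 1)
          - 2 * (j + 1) * gramCoeff N (n + 1) j)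
        - ((N : ℂ) ^ 2 - (n + 1) ^ 2) * gramCoeff N n (j + 1) := by
  obtain ⟨q, rfl⟩ := Nat.exists_eq_add_of_lt hj
  have hn : (n.factorial : ℂ) ≠ 0 := by exact_mod_cast n.factorial_ne_zero
  have hjf : (j.factorial : ℂ) ≠ 0 := by exact_mod_cast j.factorial_ne_zero
  have h1 : (n : ℂ) + 1 ≠ 0 := by exact_mod_cast n.succ_ne_zero
  have h2 : (n : ℂ) + 1 + 1 ≠ 0 := by exact_mod_cast (n + 1).succ_ne_zero
  have h3 : (j : ℂ) + 1 ≠ 0 := by exact_mod_cast j.succ_ne_zero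
  have e0 := inv_Gamma_eq ((n : ℂ) - j) (n - j + 1) (by ring)
  have e1 := inv_Gamma_eq ((n : ℂ) - j + 1) (n - j + 2) (by ring)
  have e3 := inv_Gamma_eq ((q : ℂ) + j + 1 - n) (q + j + 2 - n) (by ring)
  have e4 := inv_Gamma_eq ((q : ℂ) + j - n) (q + j + 1 - n) (by ring)
  have s1 : j + 1 + q + 1 - 1 - (j + 1) = q := by omega
  have s2 : j + 1 + q + 1 - 1 - j = q + 1 := by omega
  have s3 : n + 2 + (j + 1) = n + j + 1 + 1 + 1 := by omega
  have s4 : n + 1 + (j + 1) = n + j + 1 + 1 := by omega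
  have s5 : n + 1 + j = n + j + 1 := by omega
  have s6 : n + (j + 1) = n + j + 1 := by omega
  have a1 : (n : ℂ) - (j + 1) + 1 = n - j := by ring
  have a2 : (n : ℂ) + 1 - (j + 1) + 1 = n - j + 1 := by ring
  have a3 : (n : ℂ) + 2 - (j + 1) + 1 = n - j + 2 := by ring
  have a4 : (n : ℂ) + 1 - j + 1 = n - j + 2 := by ring
  have a5 : (j : ℂ) + 1 + q + 1 - n = q + j + 2 - n := by ring
  have a6 : (j : ℂ) + 1 + q + 1 - (n + 1) = q + j + 1 - n := by ring
  have a7 : (j : ℂ) + 1 + q + 1 - (n + 2) = q + j - n := by ring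
  simp only [gramCoeff, s1, s2, s3, s4, s5, s6, Nat.factorial_succ, Nat.cast_add, Nat.cast_mul,
    Nat.cast_one, Nat.cast_ofNat, a1, a2, a3, a4, a5, a6, a7]
  rw [e4, e3, e0, e1]
  generalize (Gamma ((n : ℂ) - j + 2))⁻¹ = G₁
  generalize (Gamma ((q : ℂ) + j + 2 - n))⁻¹ = G₂
  field_simp
  ring

lemma choose_mul_sub (k j : ℕ) :
    (k.choose j : ℂ) * ((k : ℂ) - j) = (j + 1) * (k.choose (j + 1) : ℂ) := by
  rcases le_or_gt j k with h | h
  · have := Nat.choose_succ_right_eq k j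
    rw [← Nat.cast_sub h, mul_comm ((j : ℂ) + 1)]
    exact_mod_cast this.symm
  · simp [Nat.choose_eq_zero_of_lt h, Nat.choose_eq_zero_of_lt (h.trans j.lt_succ_self)]

lemma gramSum_recurrence_partial (N n k : ℕ) (hk : k < N) (m : ℕ) (hm : m ≤ k) :
    ∑ j ∈ range (m + 1), (k.choose j : ℂ) * (((n : ℂ) + 2) ^ 2 * gramCoeff N (n + 2) j
        - (2 * n + 3) * (N - 1 - 2 * k) * gramCoeff N (n + 1) j
        + ((N : ℂ) ^ 2 - (n + 1) ^ 2) * gramCoeff N n j) =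
      2 * (2 * n + 3) * (m + 1) * k.choose (m + 1) * gramCoeff N (n + 1) m := by
  induction m with
  | zero =>
    simp only [zero_add, sum_range_one, gramCoeff_recurrence_zero, Nat.choose_zero_right,
      Nat.choose_one_right]
    push_cast
    ring
  | succ m ih =>
    rw [sum_range_succ, ih (by omega), gramCoeff_recurrence_succ N n m (by omega)]
    have h := choose_mul_sub k (m + 1)
    push_cast at h ⊢
    linear_combination (2 * (2 * (n : ℂ) + 3) * gramCoeff N (n + 1) (m + 1)) * h

lemma gramSum_recurrence (N n k : ℕ) (hk : k < N) :
    ((n : ℂ) + 2) ^ 2 * gramSum N (n + 2) k =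
      (2 * n + 3) * (N - 1 - 2 * k) * gramSum N (n + 1) k
        - ((N : ℂ) ^ 2 - (n + 1) ^ 2) * gramSum N n k := by
  have h := gramSum_recurrence_partial N n k hk k le_rfl
  rw [Nat.choose_succ_self] at h
  rw [← sub_eq_zero]
  simp only [gramSum, mul_sum, ← sum_sub_distrib]
  refine (sum_congr rfl fun j _ ↦ ?_).trans (h.trans (by simp))
  ring

lemma inv_Gamma_eq_zero {s : ℂ} (m : ℕ) (h : s = -m) : (Gamma s)⁻¹ = 0 := by
  rw [h, Gamma_neg_nat_eq_zero, inv_zero]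

lemma gramCoeff_eq_zero_of_lt {n j : ℕ} (N : ℕ) (h : n < j) : gramCoeff N n j = 0 := by
  obtain ⟨q, rfl⟩ := Nat.exists_eq_add_of_lt h
  rw [gramCoeff, inv_Gamma_eq_zero q (by push_cast; ring)]
  simp

lemma gramSum_eq_zero {N n : ℕ} (h : N ≤ n) (k : ℕ) : gramSum N n k = 0 := by
  obtain ⟨q, rfl⟩ := Nat.exists_eq_add_of_le h
  refine sum_eq_zero fun j _ ↦ ?_
  rw [gramCoeff, inv_Gamma_eq_zero (s := (N : ℂ) - (N + q : ℕ)) q (by push_cast; ring)]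
  simp

lemma gramSum_zero {N k : ℕ} (hk : k < N) : gramSum N 0 k = 1 := by
  obtain ⟨M, rfl⟩ := Nat.exists_eq_add_of_lt hk
  have hf : ((k + M).factorial : ℂ) ≠ 0 := by exact_mod_cast (k + M).factorial_ne_zero
  have hG : Gamma ((k : ℂ) + M + 1) = (k + M).factorial := by
    exact_mod_cast Gamma_nat_eq_factorial (k + M)
  rw [gramSum, sum_range_succ', sum_eq_zero fun j _ ↦ by
    rw [gramCoeff_eq_zero_of_lt _ j.succ_pos, mul_zero]]
  simp [gramCoeff, hG, hf]

lemma gramSum_one {N k : ℕ} (hk : k < N) : gramSum N 1 k = N - 1 - 2 * k := by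
  obtain ⟨M, rfl⟩ := Nat.exists_eq_add_of_lt hk
  have hf : ((k + M).factorial : ℂ) ≠ 0 := by exact_mod_cast (k + M).factorial_ne_zero
  have hG : (Gamma ((k : ℂ) + M))⁻¹ = (k + M) * ((k + M).factorial : ℂ)⁻¹ := by
    rw [inv_Gamma_eq _ _ rfl]
    congr 2
    exact_mod_cast Gamma_nat_eq_factorial (k + M)
  have h0 : gramCoeff (k + M + 1) 1 0 = k + M := by
    have h2 : Gamma ((1 : ℂ) + 1) = 1 := by simpa using Gamma_nat_eq_factorial 1
    simp [gramCoeff, hG, h2]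
    field_simp
  rcases k with _ | k
  · simp [gramSum] at h0 ⊢
    exact h0
  have h1 : gramCoeff (k + 1 + M + 1) 1 1 = -2 := by
    have s1 : k + 1 + M - 1 = k + M := by omega
    have s2 : k + 1 + M = k + M + 1 := by omega
    have hf' : ((k + M).factorial : ℂ) ≠ 0 := by exact_mod_cast (k + M).factorial_ne_zero
    have hz : (k : ℂ) + M + 1 ≠ 0 := by exact_mod_cast (k + M).succ_ne_zero
    push_cast at hG
    simp [gramCoeff, s1, hG]
    rw [s2, Nat.factorial_succ]
    push_cast
    field_simp
    ring
  rw [gramSum, sum_range_succ', sum_range_succ', sum_eq_zero fun j _ ↦ by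
    rw [gramCoeff_eq_zero_of_lt _ (by omega), mul_zero]]
  rw [h0, zero_add, h1]
  simp
  ring

lemma fpoly_eq_gramSum {N k : ℕ} (hk : k < N) {x y z : ℂ} (hx : x * z = N - 1 - 2 * k)
    (hy : 4 * y * z + x ^ 2 * z ^ 2 = (N : ℂ) ^ 2 - 1) (n : ℕ) :
    fpoly (n + 2) x y z = gramSum N (n + 1) k := by
  induction n using Nat.twoStepInduction with
  | zero => rw [fpoly, hx, gramSum_one hk]
  | one =>
    have h := gramSum_recurrence N 0 k hk
    rw [zero_add, zero_add, gramSum_zero hk, gramSum_one hk, ← hx] at h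
    simp only [fpoly, Nat.reduceAdd]
    push_cast at h
    linear_combination (-1 / 4) * h - hy / 4
  | more n ih1 ih2 =>
    have h := gramSum_recurrence N (n + 1) k hk
    have h3 : (n : ℂ) + 3 ≠ 0 := by exact_mod_cast (n + 2).succ_ne_zero
    rw [fpoly, ih1, ih2, hy, mul_assoc _ x z, hx]
    push_cast at h
    field_simp
    linear_combination -h

/-- For coprime `u ≥ 2`, `v ≥ 1`, `t = u/v`, and integers `r, p` with `1 ≤ r ≤ u−1`,
`1−r ≤ p ≤ r−1` and `p + r` odd, one has
`f_u(pv/u + 2v/u, h_{r,0;pv/u}(t) − pv/u − v/u, t)·(2·h_{r,0;pv/u}(t) − pv/u) = 0`. -/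
theorem fpoly_shifted_vanishing_first_family
    (u v : ℕ) (hu : 2 ≤ u) (hv : 1 ≤ v) (huv : Nat.Coprime u v)
    (r p : ℤ) (hr1 : 1 ≤ r) (hr2 : r ≤ (u : ℤ) - 1)
    (hp1 : 1 - r ≤ p) (hp2 : p ≤ r - 1) (hodd : Odd (p + r)) :
    fpoly u ((p : ℂ) * (v : ℂ) / (u : ℂ) + 2 * (v : ℂ) / (u : ℂ))
        (hwt ((u : ℂ) / (v : ℂ)) (r : ℂ) 0 ((p : ℂ) * (v : ℂ) / (u : ℂ))
          - (p : ℂ) * (v : ℂ) / (u : ℂ) - (v : ℂ) / (u : ℂ))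
        ((u : ℂ) / (v : ℂ)) *
      (2 * hwt ((u : ℂ) / (v : ℂ)) (r : ℂ) 0 ((p : ℂ) * (v : ℂ) / (u : ℂ))
          - (p : ℂ) * (v : ℂ) / (u : ℂ)) = 0 := by
  have hu0 : (u : ℂ) ≠ 0 := by exact_mod_cast (by omega : u ≠ 0)
  have hv0 : (v : ℂ) ≠ 0 := by exact_mod_cast (by omega : v ≠ 0)
  rcases eq_or_lt_of_le hp2 with rfl | hlt
  · refine mul_eq_zero_of_right _ ?_
    rw [hwt]
    push_cast
    field_simp
    ring
  · refine mul_eq_zero_of_left ?_ _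
    obtain ⟨w, hw⟩ := hodd
    obtain ⟨k, hk⟩ := Int.eq_ofNat_of_zero_le (by omega : 0 ≤ r - 2 - w)
    lift r to ℕ using by omega
    obtain ⟨n, rfl⟩ := Nat.exists_eq_add_of_le' hu
    obtain rfl : p = r - 3 - 2 * k := by omega
    rw [fpoly_eq_gramSum (N := r) (k := k) (by omega), gramSum_eq_zero (by omega)]
    · push_cast at hu0 ⊢
      field_simp
      ring
    · rw [hwt]
      push_cast at hu0 ⊢
      field_simp
      ring
end

section
/- Let u,v be positive integers with u ≥ 2. For every p ∈ ℂ one has the closed-form evaluation f_u(pv/u, h_{u−1,0;pv/u}(u/v), u/v) = C(2(u−1), u−1) · (∏_{j=0}^{u−2} (p + u − 2 − 2j)) / (2^{u−1}·(u−1)!), where C(2(u−1),u−1) is the central binomial coefficient. In particular this value vanishes exactly for p ∈ {2−u, 4−u, …, u−2}. -/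
open Finset in
/-- The coefficient of the falling factorial `x (x - 1) ⋯ (x - k + 1)` in the discrete Chebyshev
polynomial of degree `k + m` on `N` points, normalised by `1 / (k + m)!`. -/
noncomputable def chebCoeff (N : ℂ) (k m : ℕ) : ℂ :=
  ((2 * k + m).factorial : ℂ) / ((k + m).factorial * (k.factorial : ℂ) ^ 2 * m.factorial) *
    ∏ i ∈ range m, ((i : ℂ) + k + 1 - N)

lemma chebCoeff_succ_right (N : ℂ) (k m : ℕ) :
    chebCoeff N k (m + 1) =
      chebCoeff N k m * ((2 * k + m + 1) * (m + k + 1 - N) / ((k + m + 1) * (m + 1))) := by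
  have h1 : ((k + m).factorial : ℂ) ≠ 0 := by exact_mod_cast Nat.factorial_ne_zero _
  have h2 : (k.factorial : ℂ) ≠ 0 := by exact_mod_cast Nat.factorial_ne_zero _
  have h3 : (m.factorial : ℂ) ≠ 0 := by exact_mod_cast Nat.factorial_ne_zero _
  have h4 : (k + m + 1 : ℂ) ≠ 0 := by exact_mod_cast Nat.succ_ne_zero (k + m)
  have h5 : (m + 1 : ℂ) ≠ 0 := by exact_mod_cast Nat.succ_ne_zero m
  simp only [chebCoeff, Finset.prod_range_succ, ← add_assoc, Nat.factorial_succ]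
  push_cast
  field_simp

lemma chebCoeff_succ_left (N : ℂ) (k m : ℕ) :
    chebCoeff N k (m + 1) =
      chebCoeff N (k + 1) m * ((k + 1 - N) * (k + 1) ^ 2 / ((2 * k + m + 2) * (m + 1))) := by
  have h1 : ((k + m).factorial : ℂ) ≠ 0 := by exact_mod_cast Nat.factorial_ne_zero _
  have h2 : (k.factorial : ℂ) ≠ 0 := by exact_mod_cast Nat.factorial_ne_zero _
  have h3 : (m.factorial : ℂ) ≠ 0 := by exact_mod_cast Nat.factorial_ne_zero _
  have h4 : (k + m + 1 : ℂ) ≠ 0 := by exact_mod_cast Nat.succ_ne_zero (k + m)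
  have h5 : (m + 1 : ℂ) ≠ 0 := by exact_mod_cast Nat.succ_ne_zero m
  have h6 : (k + 1 : ℂ) ≠ 0 := by exact_mod_cast Nat.succ_ne_zero k
  have h7 : (2 * k + m + 2 : ℂ) ≠ 0 := by exact_mod_cast Nat.succ_ne_zero (2 * k + m + 1)
  have hp : ∏ i ∈ Finset.range m, (((i + 1 : ℕ) : ℂ) + k + 1 - N) =
      ∏ i ∈ Finset.range m, ((i : ℂ) + ((k + 1 : ℕ) : ℂ) + 1 - N) :=
    Finset.prod_congr rfl fun i _ => by push_cast; ring
  simp only [chebCoeff, Finset.prod_range_succ', hp]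
  rw [show 2 * (k + 1) + m = 2 * k + m + 1 + 1 by ring, show k + 1 + m = k + m + 1 by ring,
    ← add_assoc, ← add_assoc]
  simp only [Nat.factorial_succ]
  push_cast
  rw [show (2 * k + m + 1 + 1 : ℂ) = 2 * k + m + 2 by ring]
  field_simp
  ring

lemma chebCoeff_zero_right (N : ℂ) (k : ℕ) :
    chebCoeff N k 0 = (Nat.choose (2 * k) k : ℂ) / k.factorial := by
  have h2 : (k.factorial : ℂ) ≠ 0 := by exact_mod_cast Nat.factorial_ne_zero _
  have h : ((2 * k).factorial : ℂ) = Nat.choose (2 * k) k * k.factorial * k.factorial := by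
    have := Nat.choose_mul_factorial_mul_factorial (show k ≤ 2 * k by omega)
    rw [show 2 * k - k = k by omega] at this
    exact_mod_cast this.symm
  simp only [chebCoeff, add_zero, Finset.range_zero, Finset.prod_empty, Nat.factorial_zero, h]
  push_cast
  field_simp

lemma chebCoeff_succ_zero (N : ℂ) (k : ℕ) :
    (k + 1) ^ 2 * chebCoeff N (k + 1) 0 = (2 * k + 1) * 2 * chebCoeff N k 0 := by
  have h2 : (k.factorial : ℂ) ≠ 0 := by exact_mod_cast Nat.factorial_ne_zero _
  have h6 : (k + 1 : ℂ) ≠ 0 := by exact_mod_cast Nat.succ_ne_zero k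
  simp only [chebCoeff, add_zero, Finset.range_zero, Finset.prod_empty, Nat.mul_succ,
    Nat.factorial_succ, Nat.factorial_zero]
  push_cast
  field_simp
  ring

/-- The coefficient of the `k`-th falling factorial in the normalised discrete Chebyshev
polynomial of degree `n` on `N` points; it is zero for `k > n`. -/
noncomputable def chebCoeffDeg (N : ℂ) (n k : ℕ) : ℂ :=
  if k ≤ n then chebCoeff N k (n - k) else 0

lemma chebCoeffDeg_add (N : ℂ) (k m : ℕ) : chebCoeffDeg N (k + m) k = chebCoeff N k m := by
  simp [chebCoeffDeg]

lemma chebCoeffDeg_self (N : ℂ) (k : ℕ) : chebCoeffDeg N k k = chebCoeff N k 0 :=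
  chebCoeffDeg_add N k 0

lemma chebCoeffDeg_of_lt (N : ℂ) {n k : ℕ} (h : n < k) : chebCoeffDeg N n k = 0 := by
  simp [chebCoeffDeg, h]

lemma chebCoeffDeg_recurrence_zero (N : ℂ) (n : ℕ) :
    ((n : ℂ) + 2) ^ 2 * chebCoeffDeg N (n + 2) 0 =
      (2 * n + 3) * (1 - N) * chebCoeffDeg N (n + 1) 0 -
        (N ^ 2 - (n + 1) ^ 2) * chebCoeffDeg N n 0 := by
  have h1 : (n + 1 : ℂ) ≠ 0 := by exact_mod_cast Nat.succ_ne_zero n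
  have h2 : (n + 2 : ℂ) ≠ 0 := by exact_mod_cast Nat.succ_ne_zero (n + 1)
  simp only [chebCoeffDeg, Nat.zero_le, if_true, Nat.sub_zero, chebCoeff_succ_right]
  push_cast
  simp only [zero_add, mul_zero, add_zero]
  rw [show (n + 1 + 1 : ℂ) = n + 2 by ring]
  field_simp
  ring

lemma chebCoeffDeg_recurrence_succ (N : ℂ) (n k : ℕ) :
    ((n : ℂ) + 2) ^ 2 * chebCoeffDeg N (n + 2) (k + 1) =
      (2 * n + 3) * (2 * chebCoeffDeg N (n + 1) k +
        (2 * (k + 1) + 1 - N) * chebCoeffDeg N (n + 1) (k + 1)) -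
        (N ^ 2 - (n + 1) ^ 2) * chebCoeffDeg N n (k + 1) := by
  obtain h | rfl | rfl | h : n + 1 < k ∨ k = n + 1 ∨ k = n ∨ k + 1 ≤ n := by omega
  · simp [chebCoeffDeg_of_lt N (show n + 2 < k + 1 by omega), chebCoeffDeg_of_lt N h,
      chebCoeffDeg_of_lt N (show n + 1 < k + 1 by omega),
      chebCoeffDeg_of_lt N (show n < k + 1 by omega)]
  · rw [chebCoeffDeg_of_lt N (show n + 1 < n + 1 + 1 by omega),
      chebCoeffDeg_of_lt N (show n < n + 1 + 1 by omega), chebCoeffDeg_self, chebCoeffDeg_self]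
    have h := chebCoeff_succ_zero N (n + 1)
    push_cast at h
    linear_combination h
  · rw [chebCoeffDeg_of_lt N (show k < k + 1 by omega), chebCoeffDeg_self,
      show k + 2 = k + 1 + (0 + 1) by ring, chebCoeffDeg_add, chebCoeffDeg_add N k (0 + 1),
      chebCoeff_succ_right, chebCoeff_succ_left]
    have h1 : (k + 1 : ℂ) ≠ 0 := by exact_mod_cast Nat.succ_ne_zero k
    have h2 : (k + 2 : ℂ) ≠ 0 := by exact_mod_cast Nat.succ_ne_zero (k + 1)
    push_cast
    simp only [zero_add, mul_one, add_zero]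
    rw [show (2 * (k : ℂ) + 2) = 2 * (k + 1) by ring, show (k + 1 + 1 : ℂ) = k + 2 by ring]
    field_simp
    ring
  · obtain ⟨m, rfl⟩ := Nat.exists_eq_add_of_le h
    rw [show k + 1 + m + 2 = k + 1 + (m + 1 + 1) by ring, chebCoeffDeg_add, chebCoeffDeg_add,
      show k + 1 + m + 1 = k + 1 + (m + 1) by ring, chebCoeffDeg_add,
      show k + 1 + (m + 1) = k + (m + 1 + 1) by ring, chebCoeffDeg_add,
      chebCoeff_succ_left N k, chebCoeff_succ_right N _ (m + 1), chebCoeff_succ_right]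
    have h1 : (k + m + 2 : ℂ) ≠ 0 := by exact_mod_cast Nat.succ_ne_zero (k + m + 1)
    have h2 : (m + 1 : ℂ) ≠ 0 := by exact_mod_cast Nat.succ_ne_zero m
    have h3 : (m + 2 : ℂ) ≠ 0 := by exact_mod_cast Nat.succ_ne_zero (m + 1)
    have h4 : (k + m + 3 : ℂ) ≠ 0 := by exact_mod_cast Nat.succ_ne_zero (k + m + 2)
    have h5 : (k * 2 + m + 3 : ℂ) ≠ 0 := by exact_mod_cast Nat.succ_ne_zero (k * 2 + m + 2)
    push_cast
    rw [show (k + 1 + m + 1 : ℂ) = k + m + 2 by ring, show (m + 1 + 1 : ℂ) = m + 2 by ring,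
      show (k + 1 + (m + 1) + 1 : ℂ) = k + m + 3 by ring,
      show (2 * k + (m + 1) + 2 : ℂ) = k * 2 + m + 3 by ring,
      show (k + 1 + m + 2 : ℂ) = k + m + 3 by ring]
    field_simp
    ring

open Finset in
/-- The discrete Chebyshev polynomial of degree `n` on `N` points, divided by `n!`. -/
noncomputable def discreteCheb (N : ℂ) (n : ℕ) (x : ℂ) : ℂ :=
  ∑ k ∈ range (n + 1), chebCoeffDeg N n k * ∏ i ∈ range k, (x - i)

lemma discreteCheb_eq_sum_range (N : ℂ) {n K : ℕ} (h : n + 1 ≤ K) (x : ℂ) :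
    discreteCheb N n x =
      ∑ k ∈ Finset.range K, chebCoeffDeg N n k * ∏ i ∈ Finset.range k, (x - i) := by
  refine Finset.sum_subset (Finset.range_mono h) fun k _ hk => ?_
  rw [chebCoeffDeg_of_lt N (by simpa using hk), zero_mul]

lemma discreteCheb_recurrence (N : ℂ) (n : ℕ) (x : ℂ) :
    ((n : ℂ) + 2) ^ 2 * discreteCheb N (n + 2) x =
      (2 * n + 3) * (2 * x + 1 - N) * discreteCheb N (n + 1) x -
        (N ^ 2 - (n + 1) ^ 2) * discreteCheb N n x := by
  have hmul : (2 * x + 1 - N) * discreteCheb N (n + 1) x =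
      ∑ k ∈ Finset.range (n + 2), 2 * chebCoeffDeg N (n + 1) k *
          ∏ i ∈ Finset.range (k + 1), (x - i) +
        ∑ k ∈ Finset.range (n + 2 + 1), (2 * k + 1 - N) * chebCoeffDeg N (n + 1) k *
          ∏ i ∈ Finset.range k, (x - i) := by
    rw [Finset.sum_range_succ _ (n + 2), chebCoeffDeg_of_lt N (show n + 1 < n + 2 by omega),
      mul_zero, zero_mul, add_zero, ← Finset.sum_add_distrib, discreteCheb, Finset.mul_sum]
    refine Finset.sum_congr rfl fun k _ => ?_
    rw [Finset.prod_range_succ]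
    ring
  rw [mul_assoc, hmul, discreteCheb,
    discreteCheb_eq_sum_range N (show n + 1 ≤ n + 2 + 1 by omega),
    Finset.sum_range_succ' _ (n + 2), Finset.sum_range_succ' _ (n + 2),
    Finset.sum_range_succ' _ (n + 2)]
  have hs : ∑ k ∈ Finset.range (n + 2), ((n : ℂ) + 2) ^ 2 * (chebCoeffDeg N (n + 2) (k + 1) *
      ∏ i ∈ Finset.range (k + 1), (x - i)) = ∑ k ∈ Finset.range (n + 2),
      ((2 * n + 3) * (2 * chebCoeffDeg N (n + 1) k * ∏ i ∈ Finset.range (k + 1), (x - i)) +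
      (2 * n + 3) * ((2 * ((k + 1 : ℕ) : ℂ) + 1 - N) * chebCoeffDeg N (n + 1) (k + 1) *
        ∏ i ∈ Finset.range (k + 1), (x - i)) -
      (N ^ 2 - (n + 1) ^ 2) * (chebCoeffDeg N n (k + 1) *
        ∏ i ∈ Finset.range (k + 1), (x - i))) := Finset.sum_congr rfl fun k _ => by
    push_cast
    linear_combination (∏ i ∈ Finset.range (k + 1), (x - i)) * chebCoeffDeg_recurrence_succ N n k
  rw [Finset.sum_sub_distrib, Finset.sum_add_distrib, ← Finset.mul_sum, ← Finset.mul_sum,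
    ← Finset.mul_sum, ← Finset.mul_sum] at hs
  simp only [Finset.range_zero, Finset.prod_empty, Nat.cast_zero]
  linear_combination hs + chebCoeffDeg_recurrence_zero N n

lemma discreteCheb_zero (N x : ℂ) : discreteCheb N 0 x = 1 := by
  simp [discreteCheb, chebCoeffDeg, chebCoeff]

lemma discreteCheb_one (N x : ℂ) : discreteCheb N 1 x = 2 * x + 1 - N := by
  simp [discreteCheb, chebCoeffDeg, chebCoeff, Finset.sum_range_succ]
  ring

/-- On `N` points the discrete Chebyshev polynomial of degree `N` is a multiple of the
falling factorial vanishing at all of them. -/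
lemma discreteCheb_self (N : ℕ) (x : ℂ) :
    discreteCheb N N x =
      (Nat.choose (2 * N) N : ℂ) / N.factorial * ∏ i ∈ Finset.range N, (x - i) := by
  rw [discreteCheb, Finset.sum_range_succ, Finset.sum_eq_zero, zero_add, chebCoeffDeg_self,
    chebCoeff_zero_right]
  intro k hk
  obtain ⟨m, rfl⟩ := Nat.exists_eq_add_of_lt (Finset.mem_range.mp hk)
  rw [add_assoc, chebCoeffDeg_add, chebCoeff_succ_right]
  push_cast
  rw [show (m + k + 1 - (k + (m + 1)) : ℂ) = 0 by ring]
  simp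

lemma fpoly_eq_discreteCheb (N X x y z : ℂ) (hx : x * z = 2 * X + 1 - N)
    (hy : 4 * y * z + x ^ 2 * z ^ 2 = N ^ 2 - 1) (n : ℕ) :
    fpoly (n + 2) x y z = discreteCheb N (n + 1) X := by
  induction n using Nat.twoStepInduction with
  | zero => rw [discreteCheb_one, fpoly, hx]
  | one =>
    have h := discreteCheb_recurrence N 0 X
    rw [discreteCheb_zero, zero_add, zero_add, discreteCheb_one, ← hx] at h
    push_cast at h
    rw [fpoly]
    linear_combination -h / 4 - hy / 4
  | more n ih1 ih2 =>
    have h := discreteCheb_recurrence N (n + 1) X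
    have h3 : (n + 3 : ℂ) ≠ 0 := by exact_mod_cast Nat.succ_ne_zero (n + 2)
    rw [show n + 2 + 2 = n + 4 by ring, fpoly, ih1, show n + 3 = n + 1 + 2 by ring, ih2,
      mul_assoc _ x z, hx, hy]
    push_cast at h
    rw [show n + 2 + 1 = n + 1 + 2 by ring]
    field_simp
    linear_combination -h

/-- Closed-form evaluation
`f_u(pv/u, h_{u−1,0;pv/u}(u/v), u/v)
  = C(2(u−1),u−1) · ∏_{j=0}^{u−2} (p + u − 2 − 2j) / (2^{u−1}(u−1)!)`,
which vanishes exactly for `p ∈ {2−u, 4−u, …, u−2}`. -/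
theorem fpoly_top_row_closed_form (u v : ℕ) (hu : 2 ≤ u) (hv : 1 ≤ v) (p : ℂ) :
    fpoly u (p * (v : ℂ) / (u : ℂ))
        (hwt ((u : ℂ) / (v : ℂ)) ((u : ℂ) - 1) 0 (p * (v : ℂ) / (u : ℂ)))
        ((u : ℂ) / (v : ℂ)) =
      (Nat.choose (2 * (u - 1)) (u - 1) : ℂ) *
        (∏ j ∈ Finset.range (u - 1), (p + (u : ℂ) - 2 - 2 * (j : ℂ))) /
        (2 ^ (u - 1) * (Nat.factorial (u - 1) : ℂ)) ∧
    (fpoly u (p * (v : ℂ) / (u : ℂ))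
        (hwt ((u : ℂ) / (v : ℂ)) ((u : ℂ) - 1) 0 (p * (v : ℂ) / (u : ℂ)))
        ((u : ℂ) / (v : ℂ)) = 0 ↔
      ∃ j : ℕ, j ≤ u - 2 ∧ p = 2 - (u : ℂ) + 2 * (j : ℂ)) := by
  obtain ⟨N, rfl⟩ : ∃ N, u = N + 2 := ⟨u - 2, by omega⟩
  have hv' : (v : ℂ) ≠ 0 := by exact_mod_cast (show v ≠ 0 by omega)
  have hu' : ((N + 2 : ℕ) : ℂ) ≠ 0 := by exact_mod_cast (show N + 2 ≠ 0 by omega)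
  have hf : ((N + 1).factorial : ℂ) ≠ 0 := by exact_mod_cast Nat.factorial_ne_zero _
  have key : fpoly (N + 2) (p * (v : ℂ) / ((N + 2 : ℕ) : ℂ))
      (hwt (((N + 2 : ℕ) : ℂ) / (v : ℂ)) (((N + 2 : ℕ) : ℂ) - 1) 0
        (p * (v : ℂ) / ((N + 2 : ℕ) : ℂ))) (((N + 2 : ℕ) : ℂ) / (v : ℂ)) =
      (Nat.choose (2 * (N + 1)) (N + 1) : ℂ) *
        (∏ j ∈ Finset.range (N + 1), (p + ((N + 2 : ℕ) : ℂ) - 2 - 2 * (j : ℂ))) /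
        (2 ^ (N + 1) * (Nat.factorial (N + 1) : ℂ)) := by
    rw [fpoly_eq_discreteCheb ((N + 1 : ℕ) : ℂ) ((p + N) / 2), discreteCheb_self]
    · have h : ∏ j ∈ Finset.range (N + 1), (p + ((N + 2 : ℕ) : ℂ) - 2 - 2 * (j : ℂ)) =
          2 ^ (N + 1) * ∏ j ∈ Finset.range (N + 1), ((p + N) / 2 - (j : ℂ)) := by
        rw [Finset.pow_eq_prod_const, ← Finset.prod_mul_distrib]
        refine Finset.prod_congr rfl fun j _ => ?_
        push_cast
        ring
      rw [h]
      field_simp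
    · field_simp
      push_cast
      ring
    · rw [hwt]
      field_simp
      push_cast
      ring
  refine ⟨key, ?_⟩
  have hc : (Nat.choose (2 * (N + 1)) (N + 1) : ℂ) ≠ 0 := by
    exact_mod_cast (Nat.choose_pos (by omega)).ne'
  have hd : (2 : ℂ) ^ (N + 1) * ((N + 1).factorial : ℂ) ≠ 0 :=
    mul_ne_zero (pow_ne_zero _ two_ne_zero) hf
  rw [key, div_eq_zero_iff, or_iff_left hd, mul_eq_zero, or_iff_right hc,
    Finset.prod_eq_zero_iff]
  refine exists_congr fun j => and_congr ?_ ?_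
  · rw [Finset.mem_range]
    omega
  · constructor <;> intro h <;> linear_combination h
end

section
/- Let t ∈ ℂ∖{0} and let n ≥ 2 be an integer. Regard f_n(x,y,t) as a polynomial in the two variables x,y. Then: (i) its degree in x equals n−1, and the coefficient of x^{n−1} is a nonzero complex constant (independent of y); (ii) the polynomial f_n(x, γ², t) ∈ ℂ[x,γ] has total degree at most n−1; (iii) the difference f̃_n(x,y) = f_n(x,y,t) − f_n(x + 2/t, y − x − 1/t, t) has degree at most n−2 in x, and f̃_n(x, γ²) ∈ ℂ[x,γ] has total degree at most n−2. -/
open MvPolynomial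

/-- The polynomials `f_n(x,y,t)` (for a fixed parameter `t`), regarded as genuine polynomials
in the two variables `x = X 0` and `y = X 1`:
`f_2 = tx`, `f_3 = t²x²/2 − ty`, and
`f_{n+2} = ((2n+1)tx/(n+1)²) f_{n+1} − ((4ty + t²x² − (n−1)(n+1))/(n+1)²) f_n`. -/
noncomputable def fP (t : ℂ) : ℕ → MvPolynomial (Fin 2) ℂ
  | 0 => 0
  | 1 => 0
  | 2 => C t * X 0
  | 3 => C (t ^ 2 / 2) * X 0 ^ 2 - C t * X 1
  | n + 4 =>
      C ((2 * ((n : ℂ) + 2) + 1) * t / ((n : ℂ) + 3) ^ 2) * X 0 * fP t (n + 3)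
        - (C (4 * t / ((n : ℂ) + 3) ^ 2) * X 1 + C (t ^ 2 / ((n : ℂ) + 3) ^ 2) * X 0 ^ 2
            - C ((((n : ℂ) + 1) * ((n : ℂ) + 3)) / ((n : ℂ) + 3) ^ 2)) * fP t (n + 2)

/-- The polynomials all of whose monomials `x ^ a * y ^ b` satisfy `a + 2 * b < k`. -/
noncomputable def weightLT (k : ℕ) : Submodule ℂ (MvPolynomial (Fin 2) ℂ) :=
  restrictSupport ℂ {d | d 0 + 2 * d 1 < k}

theorem mem_weightLT {k : ℕ} {p : MvPolynomial (Fin 2) ℂ} :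
    p ∈ weightLT k ↔ ∀ d ∈ p.support, d 0 + 2 * d 1 < k :=
  Iff.rfl

theorem weightLT_mono {j k : ℕ} (h : j ≤ k) : weightLT j ≤ weightLT k :=
  fun _ hp _ hd => lt_of_lt_of_le (hp hd) h

theorem mul_mem_weightLT {i j k : ℕ} {p q : MvPolynomial (Fin 2) ℂ} (hp : p ∈ weightLT i)
    (hq : q ∈ weightLT j) (h : i + j ≤ k + 1) : p * q ∈ weightLT k := by
  classical
  intro d hd
  obtain ⟨a, ha, b, hb, rfl⟩ := Finset.mem_add.mp (support_mul p q hd)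
  have h₁ := mem_weightLT.mp hp a ha
  have h₂ := mem_weightLT.mp hq b hb
  simp only [Set.mem_ofPred_eq, Finsupp.add_apply]
  omega

theorem monomial_mem_weightLT {k : ℕ} {d : Fin 2 →₀ ℕ} (h : d 0 + 2 * d 1 < k) (c : ℂ) :
    monomial d c ∈ weightLT k := by
  intro e he
  rw [Finset.mem_singleton.mp (support_monomial_subset he)]
  exact h

theorem C_mem_weightLT (c : ℂ) : (C c : MvPolynomial (Fin 2) ℂ) ∈ weightLT 1 :=
  monomial_mem_weightLT (by simp) c

theorem X_zero_mem_weightLT : (X 0 : MvPolynomial (Fin 2) ℂ) ∈ weightLT 2 :=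
  monomial_mem_weightLT (by simp) 1

theorem X_one_mem_weightLT : (X 1 : MvPolynomial (Fin 2) ℂ) ∈ weightLT 3 :=
  monomial_mem_weightLT (by simp) 1

theorem sub_mul_mem_weightLT {i j k : ℕ} {p p' q q' : MvPolynomial (Fin 2) ℂ}
    (hp : p ∈ weightLT (i + 1)) (hq : q ∈ weightLT (j + 1)) (hpp : p - p' ∈ weightLT i)
    (hqq : q - q' ∈ weightLT j) (h : i + j ≤ k) : p * q - p' * q' ∈ weightLT k := by
  have hp' : p' ∈ weightLT (i + 1) := by
    have := sub_mem hp (weightLT_mono (Nat.le_succ i) hpp)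
    rwa [sub_sub_cancel] at this
  have e : p * q - p' * q' = (p - p') * q + p' * (q - q') := by ring
  rw [e]
  exact add_mem (mul_mem_weightLT hpp hq (by omega)) (mul_mem_weightLT hp' hqq (by omega))

theorem pow_mem_weightLT {i : ℕ} {p : MvPolynomial (Fin 2) ℂ} (hp : p ∈ weightLT (i + 1))
    (a : ℕ) : p ^ a ∈ weightLT (a * i + 1) := by
  induction a with
  | zero => simpa using C_mem_weightLT 1
  | succ a ih =>
    rw [pow_succ]
    exact mul_mem_weightLT ih hp (by linarith [Nat.succ_mul a i])

theorem sub_pow_mem_weightLT {i : ℕ} {p p' : MvPolynomial (Fin 2) ℂ}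
    (hp : p ∈ weightLT (i + 1)) (hpp : p - p' ∈ weightLT i) (a : ℕ) :
    p ^ a - p' ^ a ∈ weightLT (a * i) := by
  induction a with
  | zero => simp
  | succ a ih =>
    rw [pow_succ, pow_succ]
    exact sub_mul_mem_weightLT (pow_mem_weightLT hp a) hp ih hpp (Nat.succ_mul a i).ge

theorem aeval_monomial_fin_two (u v : MvPolynomial (Fin 2) ℂ) (d : Fin 2 →₀ ℕ) (c : ℂ) :
    aeval (![u, v] : Fin 2 → MvPolynomial (Fin 2) ℂ) (monomial d c)
      = C c * (u ^ d 0 * v ^ d 1) := by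
  rw [aeval_monomial, Finsupp.prod_fintype _ _ (by simp)]
  simp [Fin.prod_univ_two, algebraMap_eq]

/-- A substitution that perturbs each variable by terms of lower weight changes a polynomial
by terms of lower weight. -/
theorem sub_aeval_mem_weightLT {u v : MvPolynomial (Fin 2) ℂ} (hu : X 0 - u ∈ weightLT 1)
    (hv : X 1 - v ∈ weightLT 2) {k : ℕ} {p : MvPolynomial (Fin 2) ℂ}
    (hp : p ∈ weightLT (k + 1)) :
    p - aeval (![u, v] : Fin 2 → MvPolynomial (Fin 2) ℂ) p ∈ weightLT k := by
  have key (d : Fin 2 →₀ ℕ) (hd : d 0 + 2 * d 1 ≤ k) (c : ℂ) : monomial d c -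
      aeval (![u, v] : Fin 2 → MvPolynomial (Fin 2) ℂ) (monomial d c) ∈ weightLT k := by
    have e : monomial d c = C c * ((X 0 : MvPolynomial (Fin 2) ℂ) ^ d 0 * X 1 ^ d 1) := by
      rw [monomial_eq, Finsupp.prod_fintype _ _ (by simp), Fin.prod_univ_two]
    rw [aeval_monomial_fin_two, e, ← mul_sub]
    refine mul_mem_weightLT (C_mem_weightLT c) (sub_mul_mem_weightLT
      (pow_mem_weightLT X_zero_mem_weightLT _) (pow_mem_weightLT X_one_mem_weightLT _)
      (sub_pow_mem_weightLT X_zero_mem_weightLT hu _)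
      (sub_pow_mem_weightLT X_one_mem_weightLT hv _) (k := k) (by omega)) (by omega)
  have e : p - aeval (![u, v] : Fin 2 → MvPolynomial (Fin 2) ℂ) p =
      ∑ d ∈ p.support, (monomial d (coeff d p) -
        aeval (![u, v] : Fin 2 → MvPolynomial (Fin 2) ℂ) (monomial d (coeff d p))) := by
    rw [Finset.sum_sub_distrib, ← map_sum, support_sum_monomial_coeff]
  rw [e]
  exact sum_mem fun d hd => key d (Nat.lt_succ_iff.mp (mem_weightLT.mp hp d hd)) _

theorem totalDegree_aeval_le_of_mem_weightLT {k : ℕ} {p : MvPolynomial (Fin 2) ℂ}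
    (hp : p ∈ weightLT (k + 1)) :
    (aeval (![X 0, X 1 ^ 2] : Fin 2 → MvPolynomial (Fin 2) ℂ) p).totalDegree ≤ k := by
  rw [← support_sum_monomial_coeff p, map_sum]
  refine totalDegree_finsetSum_le fun d hd => ?_
  have hd' := mem_weightLT.mp hp d hd
  rw [aeval_monomial_fin_two, ← pow_mul]
  refine (totalDegree_mul _ _).trans ?_
  have := totalDegree_mul ((X 0 : MvPolynomial (Fin 2) ℂ) ^ d 0) (X 1 ^ (2 * d 1))
  rw [totalDegree_X_pow, totalDegree_X_pow] at this
  rw [totalDegree_C]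
  omega

theorem degreeOf_zero_le_of_mem_weightLT {k : ℕ} {p : MvPolynomial (Fin 2) ℂ}
    (hp : p ∈ weightLT (k + 1)) : degreeOf 0 p ≤ k := by
  refine degreeOf_le_iff.mpr fun d hd => ?_
  have := mem_weightLT.mp hp d hd
  omega

theorem fP_mem_weightLT (t : ℂ) : ∀ n, fP t n ∈ weightLT n
  | 0 => by simp [fP]
  | 1 => by simp [fP]
  | 2 => mul_mem_weightLT (C_mem_weightLT _) X_zero_mem_weightLT (by norm_num)
  | 3 => sub_mem
      (mul_mem_weightLT (C_mem_weightLT _) (pow_mem_weightLT X_zero_mem_weightLT 2)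
        (by norm_num))
      (mul_mem_weightLT (C_mem_weightLT _) X_one_mem_weightLT (by norm_num))
  | n + 4 => by
    rw [fP]
    refine sub_mem (mul_mem_weightLT (i := 2) (mul_mem_weightLT (C_mem_weightLT _)
        X_zero_mem_weightLT (by norm_num)) (fP_mem_weightLT t (n + 3)) (by omega))
      (mul_mem_weightLT (i := 3) (sub_mem (add_mem ?_ ?_) ?_)
        (fP_mem_weightLT t (n + 2)) (by omega))
    · exact mul_mem_weightLT (C_mem_weightLT _) X_one_mem_weightLT (by norm_num)
    · exact mul_mem_weightLT (C_mem_weightLT _) (pow_mem_weightLT X_zero_mem_weightLT 2)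
        (by norm_num)
    · exact weightLT_mono (by norm_num) (C_mem_weightLT _)

theorem coeff_single_X_zero_mul (m : ℕ) (p : MvPolynomial (Fin 2) ℂ) :
    coeff (Finsupp.single 0 (m + 1)) (X 0 * p) = coeff (Finsupp.single 0 m) p := by
  rw [Finsupp.single_add, add_comm, coeff_X_mul]

theorem coeff_single_zero_X_one_mul (m : ℕ) (p : MvPolynomial (Fin 2) ℂ) :
    coeff (Finsupp.single 0 m) (X 1 * p) = 0 := by
  rw [coeff_X_mul', if_neg]
  simp

theorem coeff_single_fP (t : ℂ) : ∀ n,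
    coeff (Finsupp.single 0 (n + 1)) (fP t (n + 2)) = t ^ (n + 1) / (n + 1).factorial
  | 0 => by simp [fP, coeff_C_mul]
  | 1 => by
    have h := coeff_single_zero_X_one_mul 2 1
    rw [mul_one] at h
    simp [fP, coeff_C_mul, coeff_X_pow, h]
  | n + 2 => by
    have h₀ : coeff (Finsupp.single 0 (n + 3)) (fP t (n + 2)) = 0 := by
      by_contra h
      have := mem_weightLT.mp (fP_mem_weightLT t (n + 2)) _ (mem_support_iff.mpr h)
      simp at this
    have h₁ := coeff_single_fP t n
    have h₂ := coeff_single_fP t (n + 1)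
    rw [fP]
    simp only [sub_mul, add_mul, mul_assoc, pow_two (X 0 : MvPolynomial (Fin 2) ℂ), coeff_sub,
      coeff_add, coeff_C_mul, coeff_single_X_zero_mul, coeff_single_zero_X_one_mul, h₀, h₁, h₂]
    have h₃ : (n : ℂ) + 3 ≠ 0 := by exact_mod_cast (n + 2).succ_ne_zero
    have h₄ : (n : ℂ) + 2 ≠ 0 := by exact_mod_cast (n + 1).succ_ne_zero
    have h₅ : ((n + 1).factorial : ℂ) ≠ 0 := by exact_mod_cast (n + 1).factorial_ne_zero
    rw [Nat.factorial_succ (n + 2), Nat.factorial_succ (n + 1)]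
    push_cast
    have h₆ : (n : ℂ) + 2 + 1 ≠ 0 := by rwa [add_assoc, two_add_one_eq_three]
    have h₇ : (n : ℂ) + 1 + 1 ≠ 0 := by rwa [add_assoc, one_add_one_eq_two]
    field_simp
    ring

/-- Degree properties of `f_n(x,y,t)` for `t ≠ 0` and `n ≥ 2`:
(i) its degree in `x` is `n−1` and the coefficient of `x^{n−1}` is a nonzero constant
(no `y` occurs in it);
(ii) `f_n(x,γ²,t)` has total degree at most `n−1`;
(iii) the difference `f̃_n(x,y) = f_n(x,y,t) − f_n(x + 2/t, y − x − 1/t, t)` has degree at most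
`n−2` in `x`, and `f̃_n(x,γ²)` has total degree at most `n−2`. -/
theorem fP_degree_bounds (t : ℂ) (ht : t ≠ 0) (n : ℕ) (hn : 2 ≤ n) :
    let ftilde : MvPolynomial (Fin 2) ℂ :=
      fP t n - aeval (![X 0 + C (2 / t), X 1 - X 0 - C (1 / t)] :
        Fin 2 → MvPolynomial (Fin 2) ℂ) (fP t n)
    (degreeOf 0 (fP t n) = n - 1 ∧
      coeff (Finsupp.single 0 (n - 1)) (fP t n) ≠ 0 ∧
      ∀ d : Fin 2 →₀ ℕ, d 0 = n - 1 → d 1 ≠ 0 → coeff d (fP t n) = 0) ∧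
    (aeval (![X 0, X 1 ^ 2] : Fin 2 → MvPolynomial (Fin 2) ℂ) (fP t n)).totalDegree ≤ n - 1 ∧
    degreeOf 0 ftilde ≤ n - 2 ∧
    (aeval (![X 0, X 1 ^ 2] : Fin 2 → MvPolynomial (Fin 2) ℂ) ftilde).totalDegree ≤ n - 2 := by
  obtain ⟨k, rfl⟩ := Nat.exists_eq_add_of_le' hn
  intro ftilde
  have hf := fP_mem_weightLT t (k + 2)
  have hc : coeff (Finsupp.single 0 (k + 1)) (fP t (k + 2)) ≠ 0 := by
    rw [coeff_single_fP]
    exact div_ne_zero (pow_ne_zero _ ht) (by exact_mod_cast (k + 1).factorial_ne_zero)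
  have hft : ftilde ∈ weightLT (k + 1) := by
    refine sub_aeval_mem_weightLT ?_ ?_ hf
    · rw [sub_add_cancel_left]
      exact neg_mem (C_mem_weightLT _)
    · rw [sub_sub, sub_sub_cancel]
      exact add_mem X_zero_mem_weightLT (weightLT_mono one_le_two (C_mem_weightLT _))
  refine ⟨⟨le_antisymm (degreeOf_zero_le_of_mem_weightLT hf) ?_, hc, fun d hd₀ hd₁ => ?_⟩,
    totalDegree_aeval_le_of_mem_weightLT hf, degreeOf_zero_le_of_mem_weightLT hft,
    totalDegree_aeval_le_of_mem_weightLT hft⟩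
  · simpa using monomial_le_degreeOf 0 (mem_support_iff.mpr hc)
  · by_contra h
    have := mem_weightLT.mp hf d (mem_support_iff.mpr h)
    omega
end

section
/- Let u,v be coprime positive integers with u ≥ 2 and set t = u/v. The set Z = {(η,Δ) ∈ ℂ² : f_u(η,Δ,t) = 0 and (f_u(η + 2/t, Δ − η − 1/t, t) − f_u(η,Δ,t))·(2Δ − η) = 0} is finite and has at most u(u−1)/2 elements. -/
open Polynomial in
/-- The discrete Chebyshev polynomials in the centred variable, normalised by `1 / n!`; the
parameter `c` is the square of the number of nodes. -/
noncomputable def gramPoly (c : ℂ) : ℕ → ℂ[X]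
  | 0 => 1
  | 1 => X
  | n + 2 => C ((2 * (n : ℂ) + 3) / ((n : ℂ) + 2) ^ 2) * (X * gramPoly c (n + 1))
      - C ((c - ((n : ℂ) + 1) ^ 2) / ((n : ℂ) + 2) ^ 2) * gramPoly c n

namespace gramPoly

open Polynomial

theorem natDegree_le_and_coeff_ne_zero (c : ℂ) (n : ℕ) :
    (gramPoly c n).natDegree ≤ n ∧ (gramPoly c n).coeff n ≠ 0 := by
  induction n using Nat.twoStepInduction with
  | zero => simp [gramPoly]
  | one => simp [gramPoly]
  | more n h₀ h₁ =>
    have hn : ((n : ℂ) + 2) ≠ 0 := by exact_mod_cast (by omega : n + 2 ≠ 0)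
    have hn' : (2 * (n : ℂ) + 3) ≠ 0 := by exact_mod_cast (by omega : 2 * n + 3 ≠ 0)
    constructor
    · rw [gramPoly]
      refine (natDegree_sub_le _ _).trans (max_le ?_ ?_)
      · refine (natDegree_C_mul_le _ _).trans (natDegree_mul_le.trans ?_)
        have := natDegree_X_le (R := ℂ)
        omega
      · exact (natDegree_C_mul_le _ _).trans (by omega)
    · have h : (gramPoly c n).coeff (n + 2) = 0 := coeff_eq_zero_of_natDegree_lt (by omega)
      rw [gramPoly, coeff_sub, coeff_C_mul, coeff_C_mul, coeff_X_mul, h, mul_zero, sub_zero]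
      exact mul_ne_zero (div_ne_zero hn' (pow_ne_zero 2 hn)) h₁.2

theorem ne_zero (c : ℂ) (n : ℕ) : gramPoly c n ≠ 0 := fun h =>
  (natDegree_le_and_coeff_ne_zero c n).2 (by rw [h, coeff_zero])

/-- Three-term recurrence. -/
theorem eval_add_two (c w : ℂ) (n : ℕ) :
    ((n : ℂ) + 2) ^ 2 * (gramPoly c (n + 2)).eval w =
      (2 * n + 3) * w * (gramPoly c (n + 1)).eval w
        - (c - ((n : ℂ) + 1) ^ 2) * (gramPoly c n).eval w := by
  have hn : ((n : ℂ) + 2) ≠ 0 := by exact_mod_cast (by omega : n + 2 ≠ 0)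
  simp only [gramPoly, eval_sub, eval_mul, eval_C, eval_X]
  field_simp

/-- The second-order difference equation together with the first-order structure relation. -/
theorem difference_and_structure (c w : ℂ) (n : ℕ) :
    ((w + 1) ^ 2 - c) * ((gramPoly c n).eval (w + 2) - (gramPoly c n).eval w)
        - ((w - 1) ^ 2 - c) * ((gramPoly c n).eval w - (gramPoly c n).eval (w - 2))
      = 4 * n * (n + 1) * (gramPoly c n).eval w ∧
    ((w + 1) ^ 2 - c) * (gramPoly c n).eval (w + 2)
        - ((w - 1) ^ 2 - c) * (gramPoly c n).eval (w - 2)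
      = 4 * (n + 1) ^ 2 * (gramPoly c (n + 1)).eval w - 4 * n * w * (gramPoly c n).eval w := by
  induction n using Nat.twoStepInduction with
  | zero =>
    constructor <;> simp [gramPoly]
    ring
  | one =>
    have h := eval_add_two c w 0
    simp only [gramPoly, eval_X, eval_one, Nat.cast_zero, zero_add] at h
    constructor
    · simp [gramPoly]; ring
    · simp only [gramPoly, eval_X, eval_one, eval_sub, eval_mul, eval_C]
      push_cast
      ring
  | more n h₀ h₁ =>
    have hn : ((n : ℂ) + 2) ^ 2 ≠ 0 :=
      pow_ne_zero 2 (by exact_mod_cast (by omega : n + 2 ≠ 0))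
    have e := eval_add_two c w n
    have e' := eval_add_two c w (n + 1)
    have ep := eval_add_two c (w + 2) n
    have em := eval_add_two c (w - 2) n
    obtain ⟨a₀, x₀⟩ := h₀
    obtain ⟨a₁, x₁⟩ := h₁
    push_cast at *
    constructor
    · apply mul_left_cancel₀ hn
      linear_combination ((w + 1) ^ 2 - c) * (ep - e) - ((w - 1) ^ 2 - c) * (e - em)
        + (2 * n + 3) * (w * a₁ + 2 * x₁) - (c - ((n : ℂ) + 1) ^ 2) * a₀
        - 4 * (n + 2) * (n + 3) * e + 8 * (2 * n + 3) * e
    · apply mul_left_cancel₀ hn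
      linear_combination ((w + 1) ^ 2 - c) * ep - ((w - 1) ^ 2 - c) * em
        + (2 * n + 3) * (w * x₁ + 2 * a₁) - (c - ((n : ℂ) + 1) ^ 2) * x₀
        - 4 * (n + 2) ^ 2 * e' + 4 * n * w * e

end gramPoly

theorem fpoly_eq_eval_gramPoly (n : ℕ) (x y z : ℂ) :
    fpoly (n + 2) x y z =
      (gramPoly (4 * (y * z) + (x * z) ^ 2 + 1) (n + 1)).eval (x * z) := by
  induction n using Nat.twoStepInduction with
  | zero => simp [fpoly, gramPoly]
  | one => simp [fpoly, gramPoly]; ring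
  | more n h₀ h₁ =>
    have hn : ((n : ℂ) + 3) ≠ 0 := by exact_mod_cast (by omega : n + 3 ≠ 0)
    have e := gramPoly.eval_add_two (4 * (y * z) + (x * z) ^ 2 + 1) (x * z) (n + 1)
    rw [fpoly, h₀, h₁]
    apply mul_left_cancel₀ (pow_ne_zero 2 hn)
    rw [show n + 1 + 2 = n + 2 + 1 from rfl] at e
    generalize gramPoly (4 * (y * z) + (x * z) ^ 2 + 1) = q at e ⊢
    push_cast at e ⊢
    field_simp
    linear_combination -e

/-- A solution of a discrete Sturm–Liouville equation with vanishing initial data either stays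
zero up to a zero of the leading coefficient, or is identically zero. -/
theorem exists_eq_zero_of_difference_eq {a b : ℕ → ℂ} {l : ℂ} (h0 : a 0 = 0)
    (h1 : b 0 * (a 1 - a 0) = 0)
    (h : ∀ i, b (i + 1) * (a (i + 2) - a (i + 1)) - b i * (a (i + 1) - a i) = l * a (i + 1))
    (ha : ∃ i, a i ≠ 0) : ∃ j, b j = 0 ∧ ∀ i ≤ j, a i = 0 := by
  have key : ∀ m, (∀ i < m, b i ≠ 0) → (∀ i ≤ m, a i = 0) ∧ b m * (a (m + 1) - a m) = 0 := by
    intro m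
    induction m with
    | zero =>
      intro _
      exact ⟨fun i hi => by rw [Nat.le_zero.1 hi, h0], h1⟩
    | succ m ih =>
      intro hb
      obtain ⟨hz, hm⟩ := ih fun i hi => hb i (by omega)
      have hs : a (m + 1) = 0 := by
        have := (mul_eq_zero.1 hm).resolve_left (hb m (by omega))
        rw [sub_eq_zero.1 this, hz m le_rfl]
      refine ⟨fun i hi => ?_, ?_⟩
      · rcases Nat.lt_or_ge i (m + 1) with hi' | hi'
        · exact hz i (by omega)
        · rwa [le_antisymm hi hi']
      · linear_combination h m + hm + l * hs
  by_cases hb : ∃ j, b j = 0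
  · classical
    exact ⟨Nat.find hb, Nat.find_spec hb, (key _ fun i hi => Nat.find_min hb hi).1⟩
  · push Not at hb
    obtain ⟨i, hi⟩ := ha
    exact absurd ((key i fun j _ => hb j).1 i le_rfl) hi

theorem Polynomial.exists_eval_add_natCast_mul_ne_zero {p : Polynomial ℂ} (hp : p ≠ 0)
    (w : ℂ) {s : ℂ} (hs : s ≠ 0) : ∃ i : ℕ, p.eval (w + s * i) ≠ 0 := by
  by_contra! h
  refine hp (p.eq_zero_of_infinite_isRoot ?_)
  refine (Set.infinite_range_of_injective (f := fun i : ℕ => w + s * i) ?_).mono ?_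
  · intro i j hij
    simpa [hs] using hij
  · rintro _ ⟨i, rfl⟩
    exact h i

theorem gramPoly.exists_node {c w : ℂ} {n : ℕ} (h0 : (gramPoly c n).eval w = 0)
    (h1 : ((w + 1) ^ 2 - c) * ((gramPoly c n).eval (w + 2) - (gramPoly c n).eval w) = 0) :
    ∃ L j : ℕ, L ≤ n ∧ j < L ∧ c = (L : ℂ) ^ 2 ∧ w = L - 1 - 2 * j := by
  set p := gramPoly c n with hp
  have hd := fun w => (difference_and_structure c w n).1
  rw [← hp] at hd
  obtain ⟨j, hj, hj'⟩ := exists_eq_zero_of_difference_eq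
    (a := fun i : ℕ => p.eval (w + 2 * i)) (b := fun i : ℕ => (w + 2 * i + 1) ^ 2 - c)
    (l := 4 * n * (n + 1)) (by simpa using h0) (by simpa using h1)
    (fun i => by
      have := hd (w + 2 * (i + 1 : ℕ))
      push_cast at this ⊢
      ring_nf at this ⊢
      exact this)
    (Polynomial.exists_eval_add_natCast_mul_ne_zero (ne_zero c n) w two_ne_zero)
  obtain ⟨k, hk, hk'⟩ := exists_eq_zero_of_difference_eq
    (a := fun i : ℕ => p.eval (w + -2 * i)) (b := fun i : ℕ => (w + -2 * i - 1) ^ 2 - c)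
    (l := 4 * n * (n + 1)) (by simpa using h0)
    (by
      have := hd w
      simp only [Nat.cast_zero, Nat.cast_one, mul_zero, add_zero, mul_one, ← sub_eq_add_neg]
      linear_combination this - h1 + 4 * n * (n + 1) * h0)
    (fun i => by
      have := hd (w + -2 * (i + 1 : ℕ))
      push_cast at this ⊢
      ring_nf at this ⊢
      linear_combination this)
    (Polynomial.exists_eval_add_natCast_mul_ne_zero (ne_zero c n) w (neg_ne_zero.2 two_ne_zero))
  have hjk : ((j : ℂ) + k + 1) ≠ 0 := by exact_mod_cast (by omega : j + k + 1 ≠ 0)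
  have hw : w = k - j := by
    have : ((j : ℂ) + k + 1) * (w - (k - j)) = 0 := by linear_combination (hj - hk) / 4
    exact sub_eq_zero.1 ((mul_eq_zero.1 this).resolve_left hjk)
  refine ⟨j + k + 1, j, ?_, by omega, ?_, ?_⟩
  · let f : ℕ → ℂ := fun i => w - 2 * k + 2 * i
    have hf : Function.Injective f := fun a b hab => by simpa [f] using hab
    have hcard : ((Finset.range (j + k + 1)).image f).card = j + k + 1 := by
      rw [Finset.card_image_of_injective _ hf, Finset.card_range]
    have hroots : ((Finset.range (j + k + 1)).image f).val ⊆ p.roots := by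
      intro r hr
      rw [Finset.mem_val] at hr
      obtain ⟨i, hi, rfl⟩ := Finset.mem_image.1 hr
      rw [Finset.mem_range] at hi
      rw [Polynomial.mem_roots (ne_zero c n), Polynomial.IsRoot.def]
      rcases le_total k i with h | h
      · rw [show f i = w + 2 * (i - k : ℕ) by simp only [f, Nat.cast_sub h]; ring]
        exact hj' (i - k) (by omega)
      · rw [show f i = w + -2 * (k - i : ℕ) by simp only [f, Nat.cast_sub h]; ring]
        exact hk' (k - i) (by omega)
    have := Polynomial.card_le_degree_of_subset_roots hroots
    rw [hcard] at this
    exact this.trans (natDegree_le_and_coeff_ne_zero c n).1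
  · push_cast
    rw [hw] at hj
    linear_combination -hj
  · push_cast
    linear_combination hw

/-- For coprime `u ≥ 2`, `v ≥ 1` and `t = u/v`, the set
`Z = {(η,Δ) : f_u(η,Δ,t) = 0 ∧ (f_u(η + 2/t, Δ − η − 1/t, t) − f_u(η,Δ,t))·(2Δ − η) = 0}`
is finite with at most `u(u−1)/2` elements. -/
theorem fpoly_simultaneous_zero_bound
    (u v : ℕ) (hu : 2 ≤ u) (hv : 1 ≤ v) (huv : Nat.Coprime u v) :
    let t : ℂ := (u : ℂ) / (v : ℂ)
    let Z : Set (ℂ × ℂ) := {p | fpoly u p.1 p.2 t = 0 ∧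
      (fpoly u (p.1 + 2 / t) (p.2 - p.1 - 1 / t) t - fpoly u p.1 p.2 t) * (2 * p.2 - p.1) = 0}
    Z.Finite ∧ Z.ncard ≤ u * (u - 1) / 2 := by
  intro t Z
  have ht : t ≠ 0 := div_ne_zero (by exact_mod_cast (by omega : u ≠ 0))
    (by exact_mod_cast (by omega : v ≠ 0))
  classical
  let S : Finset ((_ : ℕ) × ℕ) := (Finset.range u).sigma fun L => Finset.range L
  let g : ((_ : ℕ) × ℕ) → ℂ × ℂ := fun q =>
    (((q.1 : ℂ) - 1 - 2 * q.2) / t, ((q.1 : ℂ) ^ 2 - 1 - ((q.1 : ℂ) - 1 - 2 * q.2) ^ 2) / 4 / t)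
  have hS : S.card = u * (u - 1) / 2 := by
    simp [S, Finset.card_sigma, Finset.sum_range_id]
  have hZ : Z ⊆ (S.image g : Finset (ℂ × ℂ)) := by
    rintro ⟨x, y⟩ ⟨h0, h1⟩
    obtain ⟨n, rfl⟩ := Nat.exists_eq_add_of_le' hu
    simp only [fpoly_eq_eval_gramPoly] at h0 h1
    have hx : (x + 2 / t) * t = x * t + 2 := by field_simp
    have hc : 4 * ((y - x - 1 / t) * t) + (x * t + 2) ^ 2 + 1
        = 4 * (y * t) + (x * t) ^ 2 + 1 := by field_simp; ring
    rw [hx, hc] at h1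
    obtain ⟨L, j, hL, hj, hcL, hw⟩ := gramPoly.exists_node h0
      (by linear_combination (-2 * t) * h1)
    rw [Finset.coe_image]
    refine ⟨⟨L, j⟩, by simp [S]; omega, ?_⟩
    simp only [g, ← hw, ← hcL, Prod.mk.injEq]
    constructor <;> field_simp
    ring
  refine ⟨(Finset.finite_toSet _).subset hZ, ?_⟩
  calc Z.ncard ≤ (S.image g).card := by
        rw [← Set.ncard_coe_finset]
        exact Set.ncard_le_ncard hZ (Finset.finite_toSet _)
    _ ≤ S.card := Finset.card_image_le
    _ = u * (u - 1) / 2 := hS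
end

section
/- For all q₁, q₂, q₃, h₂, h₃ ∈ ℂ, the dimension over ℂ of the space Hom_A(W_{q₁} ⊗_A N_{q₂,h₂}, N_{q₃,h₃}) of left A-module homomorphisms equals 1 if q₃ − q₁ − q₂ ∈ {1, −1}, equals 2 if q₃ = q₁ + q₂, and equals 0 otherwise. -/
open MvPolynomial TensorProduct

noncomputable section

/-- The Zhu algebra `A = ℂ[Δ,η]`, with `Δ = X 0` and `η = X 1`. -/
abbrev ZhuA : Type := MvPolynomial (Fin 2) ℂ

/-- The polynomial ring `ℂ[x,y,z]`, with `x = X 0`, `y = X 1`, `z = X 2`. -/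
abbrev R3 : Type := MvPolynomial (Fin 3) ℂ

/-- The underlying space of the Zhu bimodule `W_q`: `ℂ[x,y,z] ⊗ ℂ⁴`, realised as four copies
of `ℂ[x,y,z]`, the `i`-th copy corresponding to `ℂ[x,y,z] ⊗ e_i`. -/
abbrev Wb : Type := Fin 4 → R3
def rightHom : ZhuA →+* R3 := (aeval (![X 1, X 2] : Fin 2 → R3)).toRingHom
def rightHomPi : ZhuA →+* Wb := Pi.ringHom fun _ => rightHom
instance : Module ZhuA Wb := Module.compHom Wb rightHomPi

def μv (q : ℂ) : Fin 4 → ℂ := ![q, q + 1, q - 1, q]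

def leftHom (q : ℂ) : ZhuA →+* Wb :=
  Pi.ringHom fun i => (aeval (![X 0, X 2 + C (μv q i)] : Fin 2 → R3)).toRingHom

def lmul (q : ℂ) (a : ZhuA) : Wb →ₗ[ZhuA] Wb where
  toFun m := leftHom q a * m
  map_add' m₁ m₂ := mul_add _ _ _
  map_smul' a' m := by
    show leftHom q a * (rightHomPi a' * m) = rightHomPi a' * (leftHom q a * m)
    ring

def Nmod (_q' _h : ℂ) : Type := ℂ

instance (q' h : ℂ) : AddCommGroup (Nmod q' h) := inferInstanceAs (AddCommGroup ℂ)
instance (q' h : ℂ) : Module ℂ (Nmod q' h) := inferInstanceAs (Module ℂ ℂ)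
instance (q' h : ℂ) : One (Nmod q' h) := inferInstanceAs (One ℂ)

def chiN (q' h : ℂ) : ZhuA →+* ℂ := (aeval (![h, q'] : Fin 2 → ℂ)).toRingHom

instance (q' h : ℂ) : Module ZhuA (Nmod q' h) := Module.compHom ℂ (chiN q' h)

instance (q' h : ℂ) : SMulCommClass ZhuA ℂ (Nmod q' h) :=
  ⟨fun a c x => mul_left_comm (chiN q' h a) c x⟩

instance : SMulCommClass ZhuA ℂ Wb :=
  ⟨fun a c m => by
    show rightHomPi a * (c • m) = c • (rightHomPi a * m)
    exact mul_smul_comm c (rightHomPi a) m⟩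

lemma lmul_one (q : ℂ) : lmul q 1 = LinearMap.id :=
  LinearMap.ext fun m => by
    show leftHom q 1 * m = m
    rw [map_one, one_mul]

lemma lmul_mul (q : ℂ) (a b : ZhuA) : lmul q (a * b) = (lmul q a).comp (lmul q b) :=
  LinearMap.ext fun m => by
    show leftHom q (a * b) * m = leftHom q a * (leftHom q b * m)
    rw [map_mul, mul_assoc]

lemma lmul_add (q : ℂ) (a b : ZhuA) : lmul q (a + b) = lmul q a + lmul q b :=
  LinearMap.ext fun m => by
    show leftHom q (a + b) * m = leftHom q a * m + leftHom q b * m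
    rw [map_add, add_mul]

lemma lmul_zero (q : ℂ) : lmul q (0 : ZhuA) = 0 :=
  LinearMap.ext fun m => by
    show leftHom q 0 * m = 0
    rw [map_zero, zero_mul]

/-- The left `A`-action on the tensor product `W_q ⊗_A N_{q₂,h₂}` (formed with respect to the
right `A`-module structure on `W_q`), as a ring homomorphism into the endomorphism ring. -/
def rho (q q₂ h₂ : ℂ) : ZhuA →+* Module.End ZhuA (Wb ⊗[ZhuA] Nmod q₂ h₂) where
  toFun a := LinearMap.rTensor (Nmod q₂ h₂) (lmul q a)
  map_one' := by
    show LinearMap.rTensor (Nmod q₂ h₂) (lmul q 1) = 1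
    rw [lmul_one, LinearMap.rTensor_id]
    rfl
  map_mul' a b := by
    show LinearMap.rTensor (Nmod q₂ h₂) (lmul q (a * b)) =
      LinearMap.rTensor (Nmod q₂ h₂) (lmul q a) * LinearMap.rTensor (Nmod q₂ h₂) (lmul q b)
    rw [lmul_mul, LinearMap.rTensor_comp]
    rfl
  map_zero' := by
    show LinearMap.rTensor (Nmod q₂ h₂) (lmul q 0) = 0
    rw [lmul_zero, LinearMap.rTensor_zero]
  map_add' a b := by
    show LinearMap.rTensor (Nmod q₂ h₂) (lmul q (a + b)) =
      LinearMap.rTensor (Nmod q₂ h₂) (lmul q a) + LinearMap.rTensor (Nmod q₂ h₂) (lmul q b)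
    rw [lmul_add, LinearMap.rTensor_add]

/-- Type synonym for `W_q ⊗_A N_{q₂,h₂}`, carrying the *left* `A`-module structure
(the one induced by the left `A`-action on the bimodule `W_q`). -/
def Tleft (q q₂ h₂ : ℂ) : Type := Wb ⊗[ZhuA] Nmod q₂ h₂

instance (q q₂ h₂ : ℂ) : AddCommGroup (Tleft q q₂ h₂) :=
  inferInstanceAs (AddCommGroup (Wb ⊗[ZhuA] Nmod q₂ h₂))

instance (q q₂ h₂ : ℂ) :
    Module (Module.End ZhuA (Wb ⊗[ZhuA] Nmod q₂ h₂)) (Tleft q q₂ h₂) :=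
  inferInstanceAs (Module (Module.End ZhuA (Wb ⊗[ZhuA] Nmod q₂ h₂)) (Wb ⊗[ZhuA] Nmod q₂ h₂))

instance (q q₂ h₂ : ℂ) : Module ZhuA (Tleft q q₂ h₂) :=
  Module.compHom (Tleft q q₂ h₂) (rho q q₂ h₂)


/-- Evaluation of `ℂ[x,y,z]` at the point `(h₃, h₂, q₂)`. -/
def evalPoint (q₂ h₂ h₃ : ℂ) : R3 →ₐ[ℂ] ℂ := aeval ![h₃, h₂, q₂]

lemma evalPoint_rightHom (q₂ h₂ h₃ : ℂ) (a : ZhuA) :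
    evalPoint q₂ h₂ h₃ (rightHom a) = chiN q₂ h₂ a := by
  have h : (evalPoint q₂ h₂ h₃).comp (aeval (![X 1, X 2] : Fin 2 → R3)) = aeval ![h₂, q₂] := by
    ext i
    fin_cases i <;> simp [evalPoint]
  exact DFunLike.congr_fun h a

lemma evalPoint_leftHom {q₁ q₂ h₂ q₃ h₃ : ℂ} {i : Fin 4} (hi : q₃ = q₂ + μv q₁ i) (a : ZhuA) :
    evalPoint q₂ h₂ h₃ (leftHom q₁ a i) = chiN q₃ h₃ a := by
  have h : (evalPoint q₂ h₂ h₃).comp (aeval (![X 0, X 2 + C (μv q₁ i)] : Fin 2 → R3)) =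
      aeval ![h₃, q₃] := by
    ext j
    fin_cases j <;> simp [evalPoint, hi]
  exact DFunLike.congr_fun h a

/-- The pure tensor `m ⊗ n` as an element of `W_q ⊗_A N_{q₂,h₂}` with its left `A`-action. -/
def tensor {q q₂ h₂ : ℂ} (m : Wb) (n : ℂ) : Tleft q q₂ h₂ :=
  (show Wb ⊗[ZhuA] Nmod q₂ h₂ from m ⊗ₜ[ZhuA] (show Nmod q₂ h₂ from n))

lemma smul_tensor {q q₂ h₂ : ℂ} (a : ZhuA) (m : Wb) (n : ℂ) :
    a • (tensor m n : Tleft q q₂ h₂) = tensor (leftHom q a * m) n := rfl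

lemma tensor_rightHomPi_mul {q q₂ h₂ : ℂ} (a : ZhuA) (m : Wb) (n : ℂ) :
    (tensor (rightHomPi a * m) n : Tleft q q₂ h₂) = tensor m (chiN q₂ h₂ a * n) :=
  TensorProduct.smul_tmul (R := ZhuA) a m (show Nmod q₂ h₂ from n)

lemma tensor_add {q q₂ h₂ : ℂ} (m m' : Wb) (n : ℂ) :
    (tensor (m + m') n : Tleft q q₂ h₂) = tensor m n + tensor m' n :=
  TensorProduct.add_tmul (R := ZhuA) m m' (show Nmod q₂ h₂ from n)

lemma Tleft.induction {q q₂ h₂ : ℂ} {P : Tleft q q₂ h₂ → Prop} (zero : P 0)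
    (tmul : ∀ m n, P (tensor m n)) (add : ∀ s t, P s → P t → P (s + t))
    (t : Tleft q q₂ h₂) : P t :=
  TensorProduct.induction_on (motive := P) t zero tmul add

lemma smul_Nmod {q h : ℂ} (a : ZhuA) (v : Nmod q h) : a • v = chiN q h a • v := rfl

lemma C_smul_Nmod {q h : ℂ} (s : ℂ) (v : Nmod q h) : (C s : ZhuA) • v = s • v := by
  rw [smul_Nmod]
  simp [chiN]

lemma leftHom_apply (q : ℂ) (a : ZhuA) (i : Fin 4) :
    leftHom q a i = aeval (![X 0, X 2 + C (μv q i)] : Fin 2 → R3) a := rfl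

lemma rightHomPi_apply (a : ZhuA) (i : Fin 4) :
    rightHomPi a i = aeval (![X 1, X 2] : Fin 2 → R3) a := rfl

lemma leftHom_C (q s : ℂ) : leftHom q (C s) = rightHomPi (C s) := by
  ext1 k
  simp [leftHom_apply, rightHomPi_apply]

lemma map_tensor_eq_smul {q₁ q₂ q₃ h₂ h₃ : ℂ} (f : Tleft q₁ q₂ h₂ →ₗ[ZhuA] Nmod q₃ h₃)
    (m : Wb) (n : ℂ) : f (tensor m n) = n • f (tensor m 1) := by
  have h : (tensor m n : Tleft q₁ q₂ h₂) = (C n : ZhuA) • tensor m 1 := by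
    rw [smul_tensor, leftHom_C, tensor_rightHomPi_mul]
    simp [chiN]
  rw [h, map_smul, C_smul_Nmod]

/-- A homomorphism out of `W_q ⊗_A N_{q₂,h₂}` is determined by its values at `e_i ⊗ 1`. -/
lemma map_tensor_single {q₁ q₂ q₃ h₂ h₃ : ℂ} (f : Tleft q₁ q₂ h₂ →ₗ[ZhuA] Nmod q₃ h₃)
    (i : Fin 4) (p : R3) (n : ℂ) :
    f (tensor (Pi.single i p) n) =
      (evalPoint q₂ h₂ h₃ p * n) • f (tensor (Pi.single i 1) 1) := by
  induction p using MvPolynomial.induction_on generalizing n with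
  | C a =>
    have h : (Pi.single i (C a) : Wb) = leftHom q₁ (C a) * Pi.single i 1 := by
      ext1 k
      by_cases hk : k = i
      · subst hk; simp [leftHom_apply]
      · simp [hk]
    rw [h, ← smul_tensor, map_smul, map_tensor_eq_smul, C_smul_Nmod, smul_smul]
    simp [evalPoint]
  | add p p' hp hp' =>
    rw [Pi.single_add, tensor_add, map_add, hp, hp', ← add_smul, map_add, add_mul]
  | mul_X p j hp =>
    fin_cases j
    · have h : (Pi.single i (p * X 0) : Wb) = leftHom q₁ (X 0) * Pi.single i p := by
        ext1 k
        by_cases hk : k = i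
        · subst hk; simp [leftHom_apply, mul_comm]
        · simp [hk]
      simp only [Fin.zero_eta]
      rw [h, ← smul_tensor, map_smul, hp, smul_Nmod, smul_smul]
      congr 1
      simp [evalPoint, chiN]
      ring
    · have h : (Pi.single i (p * X 1) : Wb) = rightHomPi (X 0) * Pi.single i p := by
        ext1 k
        by_cases hk : k = i
        · subst hk; simp [rightHomPi_apply, mul_comm]
        · simp [hk]
      simp only [Fin.mk_one]
      rw [h, tensor_rightHomPi_mul, hp]
      congr 1
      simp [evalPoint, chiN]
      ring
    · have h : (Pi.single i (p * X 2) : Wb) = rightHomPi (X 1) * Pi.single i p := by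
        ext1 k
        by_cases hk : k = i
        · subst hk; simp [rightHomPi_apply, mul_comm]
        · simp [hk]
      simp only [Fin.reduceFinMk]
      rw [h, tensor_rightHomPi_mul, hp]
      congr 1
      simp [evalPoint, chiN]
      ring

lemma map_tensor {q₁ q₂ q₃ h₂ h₃ : ℂ} (f : Tleft q₁ q₂ h₂ →ₗ[ZhuA] Nmod q₃ h₃)
    (m : Wb) (n : ℂ) :
    f (tensor m n) = ∑ i, (evalPoint q₂ h₂ h₃ (m i) * n) • f (tensor (Pi.single i 1) 1) := by
  have h : (tensor m n : Tleft q₁ q₂ h₂) = ∑ i, tensor (Pi.single i (m i)) n := by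
    conv_lhs => rw [← Finset.univ_sum_single m]
    exact TensorProduct.sum_tmul (R := ZhuA) Finset.univ (fun i => (Pi.single i (m i) : Wb))
      (show Nmod q₂ h₂ from n)
  rw [h, map_sum]
  exact Finset.sum_congr rfl fun i _ => map_tensor_single f i (m i) n

/-- The weight constraint imposed by the action of `η` on `e_i ⊗ 1`. -/
lemma map_tensor_single_one_eq_zero {q₁ q₂ q₃ h₂ h₃ : ℂ}
    (f : Tleft q₁ q₂ h₂ →ₗ[ZhuA] Nmod q₃ h₃) {i : Fin 4} (hi : q₃ ≠ q₂ + μv q₁ i) :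
    f (tensor (Pi.single i 1) 1) = 0 := by
  have h : (leftHom q₁ (X 1) * Pi.single i 1 : Wb) = Pi.single i (X 2 + C (μv q₁ i)) := by
    ext1 k
    by_cases hk : k = i
    · subst hk; simp [leftHom_apply]
    · simp [hk]
  have h' := map_smul f (X 1 : ZhuA) (tensor (Pi.single i 1) 1)
  rw [smul_tensor, h, map_tensor_single, smul_Nmod, ← sub_eq_zero, ← sub_smul] at h'
  refine (smul_eq_zero.mp h').resolve_left fun h0 => hi ?_
  simp [evalPoint, chiN] at h0
  linear_combination -h0

/-- The functional `m ⊗ n ↦ ∑ i, m_i(h₃, h₂, q₂) c_i n`, linear for the right `A`-action. -/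
def weightedSumRight (q₂ h₂ h₃ : ℂ) (c : Fin 4 → ℂ) :
    Wb ⊗[ZhuA] Nmod q₂ h₂ →ₗ[ZhuA] Nmod q₂ h₂ :=
  TensorProduct.lift <| LinearMap.mk₂ ZhuA
    (fun (m : Wb) (n : Nmod q₂ h₂) => (∑ i, evalPoint q₂ h₂ h₃ (m i) * c i) • n)
    (fun m m' n => by simp only [Pi.add_apply, map_add, add_mul, Finset.sum_add_distrib, add_smul])
    (fun a m n => by
      rw [smul_Nmod, smul_smul, Finset.mul_sum]
      congr 1
      refine Finset.sum_congr rfl fun i _ => ?_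
      rw [← evalPoint_rightHom q₂ h₂ h₃, ← mul_assoc, ← map_mul]
      rfl)
    (fun m n n' => smul_add _ n n')
    (fun a m n => (smul_comm a _ n).symm)

/-- `weightedSumRight` as an additive map with values in `N_{q₃,h₃}`. -/
def weightedSum {q₁ q₂ q₃ h₂ h₃ : ℂ} (c : Fin 4 → ℂ) : Tleft q₁ q₂ h₂ →+ Nmod q₃ h₃ :=
  (weightedSumRight q₂ h₂ h₃ c).toAddMonoidHom

lemma weightedSum_tensor {q₁ q₂ q₃ h₂ h₃ : ℂ} (c : Fin 4 → ℂ) (m : Wb) (n : ℂ) :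
    (weightedSum c (tensor m n : Tleft q₁ q₂ h₂) : Nmod q₃ h₃) =
      ((∑ i, evalPoint q₂ h₂ h₃ (m i) * c i) * n) • (1 : Nmod q₃ h₃) :=
  (mul_one (_ : ℂ)).symm

/-- The homomorphism of left `A`-modules taking the values `c_i` at `e_i ⊗ 1`. -/
def homOfWeights {q₁ q₂ q₃ h₂ h₃ : ℂ} (c : Fin 4 → ℂ)
    (hc : ∀ i, q₃ ≠ q₂ + μv q₁ i → c i = 0) : Tleft q₁ q₂ h₂ →ₗ[ZhuA] Nmod q₃ h₃ where
  toFun := weightedSum c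
  map_add' := map_add (weightedSum c)
  map_smul' a t := by
    rw [RingHom.id_apply]
    induction t using Tleft.induction with
    | zero => rw [smul_zero, map_zero, smul_zero]
    | tmul m n =>
      rw [smul_tensor, weightedSum_tensor, weightedSum_tensor, smul_Nmod, smul_smul,
        ← mul_assoc, Finset.mul_sum]
      congr 2
      refine Finset.sum_congr rfl fun i _ => ?_
      by_cases hi : q₃ = q₂ + μv q₁ i
      · rw [Pi.mul_apply, map_mul, evalPoint_leftHom hi, mul_assoc]
      · rw [hc i hi, mul_zero, mul_zero, mul_zero]
    | add s t hs ht => rw [smul_add, map_add, hs, ht, map_add, smul_add]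

lemma homOfWeights_tensor_single {q₁ q₂ q₃ h₂ h₃ : ℂ} (c : Fin 4 → ℂ)
    (hc : ∀ i, q₃ ≠ q₂ + μv q₁ i → c i = 0) (i : Fin 4) :
    (homOfWeights c hc : Tleft q₁ q₂ h₂ →ₗ[ZhuA] Nmod q₃ h₃) (tensor (Pi.single i 1) 1) =
      c i • (1 : Nmod q₃ h₃) := by
  refine (weightedSum_tensor (q₁ := q₁) c (Pi.single i 1) 1).trans ?_
  rw [mul_one, Finset.sum_eq_single i]
  · simp
  · intro k _ hk
    simp [hk]
  · simp

/-- Evaluation of a homomorphism at those `e_i ⊗ 1` whose weight is `q₃`. -/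
def evalWeights (q₁ q₂ q₃ h₂ h₃ : ℂ) :
    (Tleft q₁ q₂ h₂ →ₗ[ZhuA] Nmod q₃ h₃) →ₗ[ℂ] ({i // q₃ = q₂ + μv q₁ i} → Nmod q₃ h₃) where
  toFun f i := f (tensor (Pi.single i.1 1) 1)
  map_add' _ _ := rfl
  map_smul' _ _ := rfl

open Classical in
lemma evalWeights_bijective (q₁ q₂ q₃ h₂ h₃ : ℂ) :
    Function.Bijective (evalWeights q₁ q₂ q₃ h₂ h₃) := by
  constructor
  · rw [← LinearMap.ker_eq_bot, LinearMap.ker_eq_bot']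
    intro f hf
    have h0 (i : Fin 4) : f (tensor (Pi.single i 1) 1) = 0 := by
      by_cases hi : q₃ = q₂ + μv q₁ i
      · exact congrFun hf ⟨i, hi⟩
      · exact map_tensor_single_one_eq_zero f hi
    ext t
    induction t using Tleft.induction with
    | zero => rw [map_zero, map_zero]
    | tmul m n => simp only [map_tensor _ m n, h0, smul_zero, Finset.sum_const_zero,
        LinearMap.zero_apply]
    | add s t hs ht => rw [map_add, hs, ht, map_add]
  · intro c
    refine ⟨homOfWeights (fun i => if hi : q₃ = q₂ + μv q₁ i then c ⟨i, hi⟩ else (0 : ℂ))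
      fun i hi => dif_neg hi, ?_⟩
    ext ⟨i, hi⟩
    refine (homOfWeights_tensor_single (q₁ := q₁) _ (fun i hi => dif_neg hi) i).trans ?_
    exact (mul_one (_ : ℂ)).trans (dif_pos hi)

open Classical in
lemma rank_hom (q₁ q₂ q₃ h₂ h₃ : ℂ) :
    Module.rank ℂ (Tleft q₁ q₂ h₂ →ₗ[ZhuA] Nmod q₃ h₃) =
      (∑ i, if q₃ = q₂ + μv q₁ i then 1 else 0 : ℕ) := by
  rw [(LinearEquiv.ofBijective _ (evalWeights_bijective q₁ q₂ q₃ h₂ h₃)).rank_eq,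
    ← Finset.card_filter, ← Fintype.card_subtype]
  exact rank_fun'

/-- The dimension over `ℂ` of `Hom_A(W_{q₁} ⊗_A N_{q₂,h₂}, N_{q₃,h₃})` (homomorphisms of left
`A`-modules, where `W_{q₁} ⊗_A N_{q₂,h₂}` carries the left `A`-module structure) equals `1` if
`q₃ − q₁ − q₂ ∈ {1, −1}`, equals `2` if `q₃ = q₁ + q₂`, and equals `0` otherwise. -/
theorem zhu_bimodule_hom_dim (q₁ q₂ q₃ h₂ h₃ : ℂ) :
    (q₃ - q₁ - q₂ = 1 ∨ q₃ - q₁ - q₂ = -1 →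
      Module.rank ℂ (Tleft q₁ q₂ h₂ →ₗ[ZhuA] Nmod q₃ h₃) = 1) ∧
    (q₃ = q₁ + q₂ →
      Module.rank ℂ (Tleft q₁ q₂ h₂ →ₗ[ZhuA] Nmod q₃ h₃) = 2) ∧
    (q₃ - q₁ - q₂ ≠ 1 ∧ q₃ - q₁ - q₂ ≠ -1 ∧ q₃ ≠ q₁ + q₂ →
      Module.rank ℂ (Tleft q₁ q₂ h₂ →ₗ[ZhuA] Nmod q₃ h₃) = 0) := by
  classical
  rw [rank_hom, Fin.sum_univ_four]
  have h0 : q₃ = q₂ + μv q₁ 0 ↔ q₃ - q₁ - q₂ = 0 :=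
    ⟨fun h : q₃ = q₂ + q₁ => by linear_combination h,
      fun h => show q₃ = q₂ + q₁ by linear_combination h⟩
  have h1 : q₃ = q₂ + μv q₁ 1 ↔ q₃ - q₁ - q₂ = 1 :=
    ⟨fun h : q₃ = q₂ + (q₁ + 1) => by linear_combination h,
      fun h => show q₃ = q₂ + (q₁ + 1) by linear_combination h⟩
  have h2 : q₃ = q₂ + μv q₁ 2 ↔ q₃ - q₁ - q₂ = -1 :=
    ⟨fun h : q₃ = q₂ + (q₁ - 1) => by linear_combination h,
      fun h => show q₃ = q₂ + (q₁ - 1) by linear_combination h⟩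
  have h3 : q₃ = q₂ + μv q₁ 3 ↔ q₃ - q₁ - q₂ = 0 :=
    ⟨fun h : q₃ = q₂ + q₁ => by linear_combination h,
      fun h => show q₃ = q₂ + q₁ by linear_combination h⟩
  have h4 : q₃ = q₁ + q₂ ↔ q₃ - q₁ - q₂ = 0 :=
    ⟨fun h => by linear_combination h, fun h => by linear_combination h⟩
  simp only [ne_eq, h0, h1, h2, h3, h4]
  generalize q₃ - q₁ - q₂ = d
  refine ⟨?_, ?_, ?_⟩
  · rintro (rfl | rfl) <;> norm_num
  · rintro rfl
    norm_num
  · rintro ⟨ha, hb, hc⟩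
    simp [ha, hb, hc]

end
end

section
/- For all t ∈ ℂ∖{0} and all q, q₂, h₃, r, s ∈ ℂ, the following identity holds: f¹(h₃, h_{r,s;q₂}(t), q₂) · f^G(h₃, h_{r,s;q₂}(t), q₂) − (t/2)(q²−1)·(2·h_{r,s;q₂}(t) − q₂) = (q²−1)·(h₃ − h_{r,s+1;q+q₂}(t))·(h₃ − h_{r,s−1;q+q₂}(t)). -/
/-- `f¹(x,y,z) = (q−1)(x − y + 1/2 + (t/4)(q+1)(2z+q−1))`. -/
noncomputable def f1 (t q x y z : ℂ) : ℂ :=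
  (q - 1) * (x - y + 1 / 2 + t / 4 * (q + 1) * (2 * z + q - 1))

/-- `f^G(x,y,z) = (q+1)(x − y − 1/2 + (t/4)(q−1)(2z+q+1))`. -/
noncomputable def fG (t q x y z : ℂ) : ℂ :=
  (q + 1) * (x - y - 1 / 2 + t / 4 * (q - 1) * (2 * z + q + 1))

/-- The determinant identity
`f¹(h₃, h_{r,s;q₂}(t), q₂)·f^G(h₃, h_{r,s;q₂}(t), q₂) − (t/2)(q²−1)(2 h_{r,s;q₂}(t) − q₂)
  = (q²−1)(h₃ − h_{r,s+1;q+q₂}(t))(h₃ − h_{r,s−1;q+q₂}(t))`. -/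
theorem determinant_identity (t : ℂ) (ht : t ≠ 0) (q q₂ h₃ r s : ℂ) :
    f1 t q h₃ (hwt t r s q₂) q₂ * fG t q h₃ (hwt t r s q₂) q₂ -
        t / 2 * (q ^ 2 - 1) * (2 * hwt t r s q₂ - q₂) =
      (q ^ 2 - 1) * (h₃ - hwt t r (s + 1) (q + q₂)) * (h₃ - hwt t r (s - 1) (q + q₂)) := by
  unfold f1 fG hwt
  field_simp
  ring
end

section
/- Let t ∈ ℝ with 2t ∉ ℤ, and set h = 3t/4 − 1/2. Define F(x) = ∑_{n=0}^∞ ((2−3t)_n (1−t)_n / ((2−2t)_n · n!)) xⁿ (this power series converges for |x| < 1) and G(x) = x^{1−3t/2}·(1−x)^{1−3t/2}·F(x) for x ∈ (0,1). Then G is twice differentiable on (0,1) and satisfies, for every x ∈ (0,1), the second-order (BPZ) differential equation G''(x) + t·(1/(x−1) + 1/x)·G'(x) − h·t·(1/x² + 1/(x−1)²)·G(x) − 2·h·t·(1/x − 1/(x−1))·G(x) = 0. -/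
/-- The Pochhammer symbol `(a)_n`: `(a)_0 = 1`, `(a)_{n+1} = (a)_n (a + n)`. -/
noncomputable def poch (a : ℝ) : ℕ → ℝ
  | 0 => 1
  | n + 1 => poch a n * (a + n)

open Filter Topology

/-- The coefficients of the Gauss hypergeometric series. -/
noncomputable def gaussCoeff (a b c : ℝ) (n : ℕ) : ℝ :=
  poch a n * poch b n / (poch c n * (Nat.factorial n : ℝ))

/-- The coefficients of the formal derivative of the power series with coefficients `a`. -/
def derivCoeff (a : ℕ → ℝ) (n : ℕ) : ℝ := (n + 1) * a (n + 1)

theorem poch_ne_zero {c : ℝ} (hc : ∀ n : ℕ, c + n ≠ 0) (n : ℕ) : poch c n ≠ 0 := by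
  induction n with
  | zero => simp [poch]
  | succ n ih => exact mul_ne_zero ih (hc n)

theorem gaussCoeff_succ {a b c : ℝ} (hc : ∀ n : ℕ, c + n ≠ 0) (n : ℕ) :
    gaussCoeff a b c (n + 1) =
      gaussCoeff a b c n * ((a + n) * (b + n) / ((c + n) * (n + 1))) := by
  have h₁ := poch_ne_zero hc n
  have h₂ := hc n
  have h₃ : (Nat.factorial n : ℝ) ≠ 0 := by positivity
  have h₄ : (n : ℝ) + 1 ≠ 0 := by positivity
  simp only [gaussCoeff, poch, Nat.factorial_succ]
  push_cast
  field_simp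

theorem tendsto_add_natCast_div_add_natCast (a c : ℝ) :
    Tendsto (fun n : ℕ => (a + n) / (c + n)) atTop (𝓝 1) := by
  simpa [mul_comm] using tendsto_add_mul_div_add_mul_atTop_nhds a c (1 : ℝ) (one_ne_zero (α := ℝ))

theorem summable_gaussCoeff_mul_pow {a b c : ℝ} (hc : ∀ n : ℕ, c + n ≠ 0) {x : ℝ}
    (hx : |x| < 1) : Summable fun n => gaussCoeff a b c n * x ^ n := by
  have hlim : Tendsto (fun n : ℕ => |(a + n) * (b + n) / ((c + n) * (n + 1))| * |x|) atTop
      (𝓝 |x|) := by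
    have := (((tendsto_add_natCast_div_add_natCast a c).mul
      (tendsto_add_natCast_div_add_natCast b 1)).abs.mul_const |x|)
    simpa [div_mul_div_comm, add_comm] using this
  obtain ⟨r, hxr, hr⟩ := exists_between hx
  refine summable_of_ratio_norm_eventually_le hr ?_
  filter_upwards [hlim.eventually_le_const hxr] with n hn
  rw [gaussCoeff_succ hc, pow_succ, Real.norm_eq_abs, Real.norm_eq_abs]
  calc |gaussCoeff a b c n * ((a + n) * (b + n) / ((c + n) * (n + 1))) * (x ^ n * x)|
      = |(a + n) * (b + n) / ((c + n) * (n + 1))| * |x| * |gaussCoeff a b c n * x ^ n| := by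
        simp only [← abs_mul]
        congr 1
        ring
    _ ≤ r * |gaussCoeff a b c n * x ^ n| := by gcongr

theorem summable_natCast_mul_abs_mul_pow {a : ℕ → ℝ}
    (ha : ∀ x : ℝ, |x| < 1 → Summable fun n => a n * x ^ n) {r : ℝ} (hr₀ : 0 < r) (hr : r < 1) :
    Summable fun n : ℕ => |a n| * (n * r ^ (n - 1)) := by
  obtain ⟨s, hrs, hs⟩ := exists_between hr
  have hs₀ : 0 < s := hr₀.trans hrs
  obtain ⟨C, hC⟩ := (ha s (by rwa [abs_of_pos hs₀])).tendsto_atTop_zero.norm.bddAbove_range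
  have hgeom : Summable fun n : ℕ => (n : ℝ) ^ 1 * (r / s) ^ n :=
    summable_pow_mul_geometric_of_norm_lt_one 1
      (by rw [Real.norm_eq_abs, abs_of_pos (by positivity)]; exact (div_lt_one hs₀).2 hrs)
  refine Summable.of_nonneg_of_le (fun n => by positivity) (fun n => ?_)
    (hgeom.mul_left (C / r))
  have hn : |a n| * s ^ n ≤ C := by
    have := hC (Set.mem_range_self n)
    simpa [abs_mul, abs_of_pos hs₀] using this
  rcases n with _ | n
  · simp
  · calc |a (n + 1)| * (((n + 1 : ℕ) : ℝ) * r ^ (n + 1 - 1))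
        = (|a (n + 1)| * s ^ (n + 1)) / r * (((n + 1 : ℕ) : ℝ) ^ 1 * (r / s) ^ (n + 1)) := by
          rw [Nat.add_sub_cancel, div_pow]
          field_simp
          ring
      _ ≤ C / r * (((n + 1 : ℕ) : ℝ) ^ 1 * (r / s) ^ (n + 1)) := by gcongr

theorem summable_derivCoeff_mul_pow {a : ℕ → ℝ}
    (ha : ∀ x : ℝ, |x| < 1 → Summable fun n => a n * x ^ n) (x : ℝ) (hx : |x| < 1) :
    Summable fun n => derivCoeff a n * x ^ n := by
  obtain ⟨r, hxr, hr⟩ := exists_between hx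
  have h := (summable_nat_add_iff 1).2
    (summable_natCast_mul_abs_mul_pow ha ((abs_nonneg x).trans_lt hxr) hr)
  refine Summable.of_norm_bounded h fun n => ?_
  rw [derivCoeff, norm_mul, norm_mul, norm_pow, Real.norm_eq_abs x, Real.norm_eq_abs (a _),
    Real.norm_of_nonneg (by positivity), Nat.add_sub_cancel]
  push_cast
  calc ((n : ℝ) + 1) * |a (n + 1)| * |x| ^ n ≤ ((n : ℝ) + 1) * |a (n + 1)| * r ^ n := by gcongr
    _ = |a (n + 1)| * ((n + 1) * r ^ n) := by ring

theorem hasDerivAt_tsum_mul_pow {a : ℕ → ℝ}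
    (ha : ∀ x : ℝ, |x| < 1 → Summable fun n => a n * x ^ n) {x : ℝ} (hx : |x| < 1) :
    HasDerivAt (fun y => ∑' n, a n * y ^ n) (∑' n, derivCoeff a n * x ^ n) x := by
  obtain ⟨r, hxr, hr⟩ := exists_between hx
  have hr₀ : 0 < r := (abs_nonneg x).trans_lt hxr
  have hbound : ∀ n : ℕ, ∀ y ∈ Metric.ball (0 : ℝ) r,
      ‖a n * (n * y ^ (n - 1))‖ ≤ |a n| * (n * r ^ (n - 1)) := by
    intro n y hy
    have hy' : |y| ≤ r := by simpa using (mem_ball_zero_iff.1 hy).le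
    rw [norm_mul, norm_mul, norm_pow, Real.norm_eq_abs, Real.norm_eq_abs y, Real.norm_natCast]
    gcongr
  have hxmem : x ∈ Metric.ball (0 : ℝ) r := by simpa using hxr
  have hsum := summable_natCast_mul_abs_mul_pow ha hr₀ hr
  have h := hasDerivAt_tsum_of_isPreconnected hsum Metric.isOpen_ball
    (convex_ball (0 : ℝ) r).isPreconnected
    (fun n y _ => (hasDerivAt_pow n y).const_mul (a n)) hbound hxmem (ha x hx) hxmem
  refine h.congr_deriv ?_
  rw [(Summable.of_norm_bounded hsum fun n => hbound n x hxmem).tsum_eq_zero_add]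
  simp only [derivCoeff, Nat.cast_zero, zero_mul, mul_zero, zero_add, Nat.add_sub_cancel]
  refine tsum_congr fun n => ?_
  push_cast
  ring

theorem HasSum.natCast_mul_of_derivCoeff {a : ℕ → ℝ} {x s : ℝ}
    (h : HasSum (fun n => derivCoeff a n * x ^ n) s) :
    HasSum (fun n : ℕ => n * a n * x ^ n) (x * s) := by
  rw [← hasSum_nat_add_iff' 1]
  have hshift : (fun n : ℕ => ((n + 1 : ℕ) : ℝ) * a (n + 1) * x ^ (n + 1)) =
      fun n => x * (derivCoeff a n * x ^ n) := by
    ext n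
    simp only [derivCoeff]
    push_cast
    ring
  simpa only [hshift, Finset.sum_range_one, Nat.cast_zero, zero_mul, sub_zero] using h.mul_left x

/-- The Gauss hypergeometric differential equation, for the sums of the hypergeometric series and
of its formal derivatives. -/
theorem hypergeometric_equation {a b c x F F₁ F₂ : ℝ} (hc : ∀ n : ℕ, c + n ≠ 0)
    (hF : HasSum (fun n => gaussCoeff a b c n * x ^ n) F)
    (hF₁ : HasSum (fun n => derivCoeff (gaussCoeff a b c) n * x ^ n) F₁)
    (hF₂ : HasSum (fun n => derivCoeff (derivCoeff (gaussCoeff a b c)) n * x ^ n) F₂) :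
    x * (1 - x) * F₂ + (c - (a + b + 1) * x) * F₁ - a * b * F = 0 := by
  have hxF₁ := hF₁.natCast_mul_of_derivCoeff
  have hxF₂ := hF₂.natCast_mul_of_derivCoeff
  have hsum (n : ℕ) : n * derivCoeff (gaussCoeff a b c) n * x ^ n +
      derivCoeff (gaussCoeff a b c) n * x ^ n =
      derivCoeff (fun k => k * gaussCoeff a b c k) n * x ^ n := by
    simp only [derivCoeff]
    push_cast
    ring
  have hsq : HasSum (fun n : ℕ => n * (n * gaussCoeff a b c n) * x ^ n)
      (x * (x * F₂ + F₁)) := by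
    refine HasSum.natCast_mul_of_derivCoeff (a := fun k => k * gaussCoeff a b c k) ?_
    simpa only [hsum] using hxF₂.add hF₁
  have hleft := hxF₂.add (hF₁.mul_left c)
  have hright := (hsq.add (hxF₁.mul_left (a + b))).add (hF.mul_left (a * b))
  have hterm (n : ℕ) : n * derivCoeff (gaussCoeff a b c) n * x ^ n +
      c * (derivCoeff (gaussCoeff a b c) n * x ^ n) =
      n * (n * gaussCoeff a b c n) * x ^ n + (a + b) * (n * gaussCoeff a b c n * x ^ n) +
        a * b * (gaussCoeff a b c n * x ^ n) := by
    have h₁ := hc n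
    have h₂ : (n : ℝ) + 1 ≠ 0 := by positivity
    simp only [derivCoeff, gaussCoeff_succ hc n]
    field_simp
    ring
  simp only [hterm] at hleft
  have heq := hleft.unique hright
  linear_combination heq

theorem hasDerivAt_rpow_mul_one_sub_rpow (α : ℝ) {x : ℝ} (hx : x ∈ Set.Ioo (0 : ℝ) 1) :
    HasDerivAt (fun y : ℝ => y ^ α * (1 - y) ^ α)
      (x ^ α * (1 - x) ^ α * (α * (1 / x + 1 / (x - 1)))) x := by
  have hx₀ : x ≠ 0 := hx.1.ne'
  have hx₁ : 1 - x ≠ 0 := (sub_pos.2 hx.2).ne'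
  have h := (Real.hasDerivAt_rpow_const (p := α) (Or.inl hx₀)).mul
    (((hasDerivAt_id x).const_sub 1).rpow_const (p := α) (Or.inl hx₁))
  refine h.congr_deriv ?_
  simp only [id, Real.rpow_sub_one hx₀, Real.rpow_sub_one hx₁]
  rw [← neg_sub 1 x]
  field_simp

/-- Let `t ∈ ℝ` with `2t ∉ ℤ`, `h = 3t/4 − 1/2`,
`F(x) = ∑_{n≥0} ((2−3t)_n (1−t)_n / ((2−2t)_n n!)) xⁿ` (which converges for `|x| < 1`), and
`G(x) = x^{1−3t/2} (1−x)^{1−3t/2} F(x)` on `(0,1)`. Then `G` is twice differentiable on `(0,1)`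
and satisfies the BPZ differential equation
`G'' + t(1/(x−1) + 1/x) G' − h t (1/x² + 1/(x−1)²) G − 2 h t (1/x − 1/(x−1)) G = 0`. -/
theorem bpz_equation_for_degenerate_four_point_function
    (t : ℝ) (ht : ∀ m : ℤ, (m : ℝ) ≠ 2 * t) :
    let h : ℝ := 3 * t / 4 - 1 / 2
    let F : ℝ → ℝ := fun x => ∑' n : ℕ,
      poch (2 - 3 * t) n * poch (1 - t) n / (poch (2 - 2 * t) n * (Nat.factorial n : ℝ)) * x ^ n
    let G : ℝ → ℝ := fun x => x ^ (1 - 3 * t / 2) * (1 - x) ^ (1 - 3 * t / 2) * F x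
    (∀ x : ℝ, |x| < 1 → Summable fun n : ℕ =>
      poch (2 - 3 * t) n * poch (1 - t) n / (poch (2 - 2 * t) n * (Nat.factorial n : ℝ)) *
        x ^ n) ∧
    ∃ G' G'' : ℝ → ℝ, ∀ x ∈ Set.Ioo (0 : ℝ) 1,
      HasDerivAt G (G' x) x ∧ HasDerivAt G' (G'' x) x ∧
      G'' x + t * (1 / (x - 1) + 1 / x) * G' x
        - h * t * (1 / x ^ 2 + 1 / (x - 1) ^ 2) * G x
        - 2 * h * t * (1 / x - 1 / (x - 1)) * G x = 0 := by
  intro h F G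
  have hc : ∀ n : ℕ, 2 - 2 * t + n ≠ 0 := fun n hn =>
    ht (n + 2) (by push_cast; linarith)
  set u := gaussCoeff (2 - 3 * t) (1 - t) (2 - 2 * t)
  have hu : ∀ x : ℝ, |x| < 1 → Summable fun n => u n * x ^ n :=
    fun x hx => summable_gaussCoeff_mul_pow hc hx
  have hu₁ := summable_derivCoeff_mul_pow hu
  have hu₂ := summable_derivCoeff_mul_pow hu₁
  refine ⟨hu, ?_⟩
  set F₁ : ℝ → ℝ := fun x => ∑' n, derivCoeff u n * x ^ n
  set F₂ : ℝ → ℝ := fun x => ∑' n, derivCoeff (derivCoeff u) n * x ^ n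
  set α : ℝ := 1 - 3 * t / 2 with hα
  set P : ℝ → ℝ := fun x => x ^ α * (1 - x) ^ α
  set L : ℝ → ℝ := fun x => α * (1 / x + 1 / (x - 1))
  set L' : ℝ → ℝ := fun x => α * (-1 / x ^ 2 + -1 / (x - 1) ^ 2)
  refine ⟨fun x => P x * (L x * F x + F₁ x),
    fun x => P x * L x * (L x * F x + F₁ x) + P x * (L' x * F x + L x * F₁ x + F₂ x), ?_⟩
  intro x hx
  have hx₁ : |x| < 1 := by rw [abs_of_pos hx.1]; exact hx.2
  have hx₀ : x ≠ 0 := hx.1.ne'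
  have hx₂ : x - 1 ≠ 0 := (sub_neg.2 hx.2).ne
  have hP : HasDerivAt P (P x * L x) x := hasDerivAt_rpow_mul_one_sub_rpow α hx
  have hF : HasDerivAt F (F₁ x) x := hasDerivAt_tsum_mul_pow hu hx₁
  have hF₁ : HasDerivAt F₁ (F₂ x) x := hasDerivAt_tsum_mul_pow hu₁ hx₁
  have hL : HasDerivAt L (L' x) x := by
    have h₁ := (hasDerivAt_id x).fun_inv hx₀
    have h₂ := ((hasDerivAt_id x).sub_const 1).fun_inv hx₂
    simpa [L, L', one_div] using (h₁.add h₂).const_mul α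
  refine ⟨?_, hP.mul ((hL.mul hF).add hF₁), ?_⟩
  · exact (hP.mul hF).congr_deriv (by ring)
  · have hode : x * (1 - x) * F₂ x +
        (2 - 2 * t - (2 - 3 * t + (1 - t) + 1) * x) * F₁ x -
        (2 - 3 * t) * (1 - t) * F x = 0 :=
      hypergeometric_equation hc (hu x hx₁).hasSum (hu₁ x hx₁).hasSum (hu₂ x hx₁).hasSum
    have hG : G x = P x * F x := rfl
    rw [hG]
    simp only [L, L', h, hα]
    field_simp
    linear_combination (-16 * P x * x * (x - 1)) * hode
end

section
/- Let t ∈ ℂ with 2t ∉ ℤ and 3t ∉ ℤ. Then (Γ(2−2t)·Γ(2t−1) / (Γ(t)·Γ(1−t)))² + (Γ(2−2t)·Γ(1−2t) / (Γ(2−3t)·Γ(1−t))) · (Γ(2t)·Γ(2t−1) / (Γ(t)·Γ(3t−1))) = 1, where Γ denotes the Gamma function. (This is the evaluation, via the hypergeometric connection formula and Euler's reflection formula, showing that the crossing combination of connection coefficients for ₂F₁(2−3t, 1−t, 2−2t; ·) equals 1; in the paper t = u/v.) -/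
open Complex

/-- Euler's reflection formula at a point shifted by one. -/
theorem Complex.Gamma_two_sub_mul_Gamma_sub_one (z : ℂ) :
    Gamma (2 - z) * Gamma (z - 1) = -(Real.pi / sin (Real.pi * z)) := by
  have h := Gamma_mul_Gamma_one_sub (z - 1)
  rw [show 1 - (z - 1) = 2 - z by ring, mul_sub, mul_one, sin_sub_pi, div_neg] at h
  rw [mul_comm, h]

theorem Complex.sin_pi_mul_ne_zero {z : ℂ} (hz : ∀ m : ℤ, (m : ℂ) ≠ z) :
    sin (Real.pi * z) ≠ 0 := by
  rw [sin_ne_zero_iff]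
  intro k hk
  refine hz k (mul_left_cancel₀ (ofReal_ne_zero.2 Real.pi_ne_zero) ?_)
  rw [hk, mul_comm]

theorem Complex.sin_sq_add_sin_mul_sin_three_mul (s : ℂ) :
    sin s ^ 2 + sin s * sin (3 * s) = sin (2 * s) ^ 2 := by
  rw [sin_three_mul, sin_two_mul, mul_pow, mul_pow, cos_sq']
  ring

/-- For `t ∈ ℂ` with `2t ∉ ℤ` and `3t ∉ ℤ`, the crossing combination of hypergeometric
connection coefficients
`(Γ(2−2t)Γ(2t−1)/(Γ(t)Γ(1−t)))² + (Γ(2−2t)Γ(1−2t)/(Γ(2−3t)Γ(1−t)))·(Γ(2t)Γ(2t−1)/(Γ(t)Γ(3t−1)))`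
equals `1`. -/
theorem gamma_connection_coefficient_identity (t : ℂ)
    (h2 : ∀ m : ℤ, (m : ℂ) ≠ 2 * t) (h3 : ∀ m : ℤ, (m : ℂ) ≠ 3 * t) :
    (Complex.Gamma (2 - 2 * t) * Complex.Gamma (2 * t - 1) /
        (Complex.Gamma t * Complex.Gamma (1 - t))) ^ 2 +
      Complex.Gamma (2 - 2 * t) * Complex.Gamma (1 - 2 * t) /
          (Complex.Gamma (2 - 3 * t) * Complex.Gamma (1 - t)) *
        (Complex.Gamma (2 * t) * Complex.Gamma (2 * t - 1) /
          (Complex.Gamma t * Complex.Gamma (3 * t - 1))) = 1 := by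
  have hpi : (Real.pi : ℂ) ≠ 0 := ofReal_ne_zero.2 Real.pi_ne_zero
  have hs2 := sin_pi_mul_ne_zero h2
  have hs3 := sin_pi_mul_ne_zero h3
  have hs1 : sin (Real.pi * t) ≠ 0 := by
    refine sin_pi_mul_ne_zero fun m hm => h2 (2 * m) ?_
    rw [← hm]
    push_cast
    rfl
  have e1 := Gamma_mul_Gamma_one_sub t
  have e2 := Gamma_mul_Gamma_one_sub (2 * t)
  have e3 := Gamma_two_sub_mul_Gamma_sub_one (2 * t)
  have e4 := Gamma_two_sub_mul_Gamma_sub_one (3 * t)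
  have htrig := sin_sq_add_sin_mul_sin_three_mul (Real.pi * t)
  rw [mul_left_comm 3, mul_left_comm 2] at htrig
  rw [div_mul_div_comm,
    show Gamma (2 - 2 * t) * Gamma (1 - 2 * t) * (Gamma (2 * t) * Gamma (2 * t - 1)) =
      Gamma (2 - 2 * t) * Gamma (2 * t - 1) * (Gamma (2 * t) * Gamma (1 - 2 * t)) by ring,
    show Gamma (2 - 3 * t) * Gamma (1 - t) * (Gamma t * Gamma (3 * t - 1)) =
      Gamma (2 - 3 * t) * Gamma (3 * t - 1) * (Gamma t * Gamma (1 - t)) by ring,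
    e1, e2, e3, e4]
  clear e1 e2 e3 e4
  generalize sin (Real.pi * t) = a at *
  generalize sin (Real.pi * (2 * t)) = b at *
  generalize sin (Real.pi * (3 * t)) = c at *
  field_simp
  linear_combination htrig
end
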